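/- Let d ≥ 2, ξ ∈ ℝ^d, M0 ∈ SL(d,ℝ), r > 0 and 0 < η < d. For every ε > 0 there exists C > 0 such that for all R ≥ 2 and all t > 0: ∫_{[−1,1]^{d−1}} F_{R,η,r}( Γ' (1,ξ)(M0 ñ(y) Φ_t, 0) ) dy ≤ C · R^{−(d−η)+ε}. -/

import Mathlib

open MeasureTheory Filter Matrix
open scoped Topology Classical

noncomputable section

/-- Distance from `x : ℝ` to the nearest integer. -/
def distToInt (x : ℝ) : ℝ := |x - round x|

/-- ζ(ξ,T) from the paper. -/
def zetaDio {d : ℕ} (ξ : Fin d → ℝ) (T : ℝ) : ℕ :=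
  sInf {N : ℕ | ∃ m : Fin d → ℤ, m ≠ 0 ∧ (∀ i, |m i| ≤ (N : ℤ)) ∧
    distToInt (∑ i, ξ i * (m i : ℝ)) ≤ 1 / T}

/-- Euclidean norm on row vectors. -/
def enorm' {d : ℕ} (x : Fin d → ℝ) : ℝ := Real.sqrt (∑ i, (x i) ^ 2)

/-- π₁ : ℝ^d → ℝ, the first coordinate. -/
def head' {d : ℕ} (x : Fin d → ℝ) : ℝ := if h : 0 < d then x ⟨0, h⟩ else 0

/-- The upper triangular unipotent matrix n(u). -/
def nMat (d : ℕ) (u : Fin d → Fin d → ℝ) : Matrix (Fin d) (Fin d) ℝ :=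
  Matrix.of fun i j => if i = j then 1 else if i < j then u i j else 0

/-- The constant c_d = d (2/√3)^d. -/
def cd' (d : ℕ) : ℝ := d * (2 / Real.sqrt 3) ^ d

/-- The constant δ_d = d·4^d. -/
def deltad (d : ℕ) : ℝ := d * 4 ^ d

/-- Siegel conditions on the diagonal part v. -/
def SiegelV (d : ℕ) (v : Fin d → ℝ) : Prop :=
  (∀ i, 0 < v i) ∧ (∏ i, v i = 1) ∧
  ∀ i j : Fin d, (i : ℕ) + 1 = (j : ℕ) → v j ≤ 2 / Real.sqrt 3 * v i

/-- s_r(g): the largest index 1 ≤ i ≤ d−1 (1-based) with v_i > 2 c_d r, or 0. -/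
def sVal (d : ℕ) (r : ℝ) (v : Fin d → ℝ) : ℕ :=
  sSup {s : ℕ | 1 ≤ s ∧ s ≤ d - 1 ∧ ∃ i : Fin d, (i : ℕ) + 1 = s ∧ 2 * cd' d * r < v i}

/-- The function F_{R,η,r} expressed in the Siegel coordinates (v, b). -/
def Ffun (d : ℕ) (R η r : ℝ) (v b : Fin d → ℝ) : ℝ :=
  (if R ≤ ∏ i ∈ Finset.univ.filter (fun i : Fin d => (i : ℕ) < sVal d r v), v i
    then 1 else 0) *
  ∏ i ∈ Finset.univ.filter (fun i : Fin d => (i : ℕ) < sVal d r v),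
    (v i ^ η * if |v i * b i| ≤ cd' d * r then 1 else 0)

/-- g' = (γ,m)·g for some (γ,m) ∈ Γ' = SL(d,ℤ) ⋉ ℤ^d, where group elements of
G' = SL(d,ℝ) ⋉ ℝ^d are represented as pairs (M,b) with (M,b)(M',b') = (MM', bM'+b'). -/
def gammaRel (d : ℕ) (g g' : Matrix (Fin d) (Fin d) ℝ × (Fin d → ℝ)) : Prop :=
  ∃ (γ : Matrix (Fin d) (Fin d) ℤ) (m : Fin d → ℤ), γ.det = 1 ∧
    g'.1 = (γ.map fun x => (x : ℝ)) * g.1 ∧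
    g'.2 = Matrix.vecMul (fun i => (m i : ℝ)) g.1 + g.2

/-- A measurable section of Γ'\G' into the Siegel set 𝒮', recorded through its
Iwasawa coordinates: `vc g` and `bc g` are the v- and b-coordinates of the Siegel
representative of Γ'g, for every g ∈ G'. -/
def IsSiegelSection (d : ℕ)
    (vc bc : (Matrix (Fin d) (Fin d) ℝ × (Fin d → ℝ)) → (Fin d → ℝ)) : Prop :=
  Measurable (fun g : (Fin d → Fin d → ℝ) × (Fin d → ℝ) => vc (Matrix.of g.1, g.2)) ∧
  Measurable (fun g : (Fin d → Fin d → ℝ) × (Fin d → ℝ) => bc (Matrix.of g.1, g.2)) ∧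
  ∀ g : Matrix (Fin d) (Fin d) ℝ × (Fin d → ℝ), g.1.det = 1 →
    SiegelV d (vc g) ∧ (∀ i, |bc g i| ≤ 1 / 2) ∧
    ∃ (u : Fin d → Fin d → ℝ) (k : Matrix (Fin d) (Fin d) ℝ),
      (∀ i j : Fin d, i < j → |u i j| ≤ 1 / 2) ∧ k * kᵀ = 1 ∧ k.det = 1 ∧
      gammaRel d g
        (nMat d u * Matrix.diagonal (vc g) * k,
         Matrix.vecMul (bc g) (nMat d u * Matrix.diagonal (vc g) * k))

/-- The matrix ñ(y), with ones on the diagonal and first row (1, y). -/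
def ntilde (d : ℕ) (y : Fin (d - 1) → ℝ) : Matrix (Fin d) (Fin d) ℝ :=
  Matrix.of fun i j =>
    if i = j then 1
    else if h : (i : ℕ) = 0 ∧ 1 ≤ (j : ℕ) then
      y ⟨(j : ℕ) - 1, by have := j.isLt; omega⟩
    else 0

/-- The diagonal flow Φ_t. -/
def Phi (d : ℕ) (t : ℝ) : Matrix (Fin d) (Fin d) ℝ :=
  Matrix.diagonal fun i : Fin d =>
    if (i : ℕ) = 0 then Real.exp (-((d : ℝ) - 1) * t / d) else Real.exp (t / d)

/-- The element Γ'(1,ξ)(M₀ ñ(y) Φ_t, 0) represented in G' as a pair. -/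
def gElt (d : ℕ) (ξ : Fin d → ℝ) (M0 : Matrix (Fin d) (Fin d) ℝ)
    (y : Fin (d - 1) → ℝ) (t : ℝ) : Matrix (Fin d) (Fin d) ℝ × (Fin d → ℝ) :=
  (M0 * ntilde d y * Phi d t, Matrix.vecMul ξ (M0 * ntilde d y * Phi d t))

/-- π' : ℝ^d → ℝ^{d-1}, dropping the first coordinate. -/
def tail' {d : ℕ} (x : Fin d → ℝ) : Fin (d - 1) → ℝ :=
  fun i => x ⟨(i : ℕ) + 1, by have := i.isLt; omega⟩

/-- The lattice Λ = ℤ^d (M₀^{-1})ᵀ. -/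
def Lam (d : ℕ) (M0 : Matrix (Fin d) (Fin d) ℝ) : Set (Fin d → ℝ) :=
  {x | ∃ m : Fin d → ℤ, x = Matrix.vecMul (fun i => (m i : ℝ)) (M0⁻¹)ᵀ}

/-- Λ_k = ℛ_k ∩ Λ. Here `‖tail' x‖` is the sup norm |π'x|. -/
def LamK (d : ℕ) (M0 : Matrix (Fin d) (Fin d) ℝ) (k : ℤ) : Set (Fin d → ℝ) :=
  {x ∈ Lam d M0 | |head' x| < (2:ℝ) ^ (k + 2) ∧ (2:ℝ) ^ k ≤ ‖tail' x‖ ∧ ‖tail' x‖ < (2:ℝ) ^ (k + 1)}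

/-- Norm of the wedge product via the Gram determinant. -/
def wedgeNorm {d n : ℕ} (x : Fin n → Fin d → ℝ) : ℝ :=
  Real.sqrt (Matrix.det (Matrix.of fun i j : Fin n => ∑ t, x i t * x j t))

/-- Norm of the wedge of the first j vectors (empty wedge has norm 1). -/
def prefixWedge {d s : ℕ} (x : Fin s → Fin d → ℝ) (j : ℕ) : ℝ :=
  wedgeNorm fun i : Fin (min j s) => x ⟨(i : ℕ), by have := i.isLt; omega⟩

/-- The set Λ_k(p). -/
def LamKP (d s : ℕ) (M0 : Matrix (Fin d) (Fin d) ℝ) (k : Fin s → ℤ) (p : Fin s → ℕ) :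
    Set (Fin s → Fin d → ℝ) :=
  {x | (∀ j, x j ∈ LamK d M0 (k j)) ∧
    ∀ j : Fin s,
      (2:ℝ) ^ (-(p j : ℤ) - 1) * enorm' (x j) * prefixWedge x (j : ℕ) < prefixWedge x ((j : ℕ) + 1) ∧
      prefixWedge x ((j : ℕ) + 1) ≤ (2:ℝ) ^ (-(p j : ℤ)) * enorm' (x j) * prefixWedge x (j : ℕ)}

/-- Operator norm ‖M₀‖ of a matrix acting on Euclidean space. -/
def opNorm {d : ℕ} (M : Matrix (Fin d) (Fin d) ℝ) : ℝ :=
  ‖LinearMap.toContinuousLinearMap (Matrix.toEuclideanLin M)‖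

/-- K₀ is the largest integer such that
{x ∈ Λ : |π₁x| < 2^{k+1}, |π'x| < 2^k} = ∅ for all k ≤ K₀. -/
def IsK0 (d : ℕ) (M0 : Matrix (Fin d) (Fin d) ℝ) (K0 : ℤ) : Prop :=
  (∀ k : ℤ, k ≤ K0 → ¬ ∃ x ∈ Lam d M0, |head' x| < (2:ℝ) ^ (k + 1) ∧ ‖tail' x‖ < (2:ℝ) ^ k) ∧
  (∀ K' : ℤ, (∀ k : ℤ, k ≤ K' → ¬ ∃ x ∈ Lam d M0, |head' x| < (2:ℝ) ^ (k + 1) ∧ ‖tail' x‖ < (2:ℝ) ^ k) → K' ≤ K0)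



/-- lattice data -/
structure LatD (d : ℕ) (c : ℝ) (φ : (Fin d → ℤ) →+ EuclideanSpace ℝ (Fin d)) : Prop where
  one_le : 1 ≤ c
  lower : ∀ m i, |(m i : ℝ)| ≤ c * ‖φ m‖
  near : ∀ z, ∃ m, ‖z - φ m‖ ≤ c

theorem lat_inj {d : ℕ} {c : ℝ} {φ : (Fin d → ℤ) →+ EuclideanSpace ℝ (Fin d)} (h : LatD d c φ)
    (m : Fin d → ℤ) (hm : c * ‖φ m‖ < 1) : m = 0 := by
  funext i
  have h1 := (h.lower m i).trans_lt hm
  have h2 : |m i| < 1 := by exact_mod_cast h1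
  simpa using Int.abs_lt_one_iff.mp h2

theorem ball_count {d : ℕ} {c : ℝ} {φ : (Fin d → ℤ) →+ EuclideanSpace ℝ (Fin d)} (h : LatD d c φ)
    (A : ℝ) (hA : 1 ≤ A) (T : Finset (Fin d → ℤ)) (hT : ∀ m ∈ T, ‖φ m‖ ≤ A) :
    (T.card : ℝ) ≤ (3 * c * A) ^ d := by
  have hc := h.one_le
  have hcA : 1 ≤ c * A := one_le_mul_of_one_le_of_one_le hc hA
  have hsub : T ⊆ Fintype.piFinset (fun _ : Fin d => Finset.Icc (-⌊c * A⌋) ⌊c * A⌋) := by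
    intro m hm
    rw [Fintype.mem_piFinset]
    intro i
    have h1 : |(m i : ℝ)| ≤ c * A := (h.lower m i).trans (by
      have := hT m hm
      gcongr)
    rw [abs_le] at h1
    rw [Finset.mem_Icc]
    have h3 : m i ≤ ⌊c * A⌋ := Int.le_floor.mpr h1.2
    have h4 : - m i ≤ ⌊c * A⌋ := Int.le_floor.mpr (by push_cast; linarith)
    constructor <;> omega
  have h2 := Finset.card_le_card hsub
  rw [Fintype.card_piFinset] at h2
  simp only [Int.card_Icc, Finset.prod_const, Finset.card_univ, Fintype.card_fin] at h2
  have h5 : (T.card : ℝ) ≤ (((⌊c * A⌋ + 1 - -⌊c * A⌋).toNat : ℕ) : ℝ) ^ d := by exact_mod_cast h2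
  refine h5.trans ?_
  gcongr
  have h6 : 0 ≤ ⌊c * A⌋ := Int.floor_nonneg.mpr (by linarith)
  have h7 : (((⌊c * A⌋ + 1 - -⌊c * A⌋).toNat : ℕ) : ℝ) = ((⌊c * A⌋ + 1 - -⌊c * A⌋ : ℤ) : ℝ) := by
    have : (((⌊c * A⌋ + 1 - -⌊c * A⌋).toNat : ℕ) : ℤ) = (⌊c * A⌋ + 1 - -⌊c * A⌋ : ℤ) :=
      Int.toNat_of_nonneg (by omega)
    exact_mod_cast this
  rw [h7]
  push_cast
  have := Int.floor_le (c * A)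
  linarith

theorem slab_count {d : ℕ} {c : ℝ} {φ : (Fin d → ℤ) →+ EuclideanSpace ℝ (Fin d)} (h : LatD d c φ)
    (f1 f2 : EuclideanSpace ℝ (Fin d)) (h1 : ‖f1‖ = 1) (h2 : ‖f2‖ = 1) (h12 : inner ℝ f1 f2 = 0)
    (A ρ : ℝ) (hρ : 1 ≤ ρ) (hA : ρ ≤ A) (T : Finset (Fin d → ℤ)) (hT : ∀ m ∈ T, ‖φ m‖ ≤ A)
    (hf1 : ∀ m ∈ T, |inner ℝ f1 (φ m)| ≤ ρ) (hf2 : ∀ m ∈ T, |inner ℝ f2 (φ m)| ≤ ρ) :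
    (T.card : ℝ) * (A / ρ) ^ 2 ≤ 4 * (3 * c * (13 * c)) ^ d * A ^ d := by
  have hc := h.one_le
  set N := ⌊A / ρ⌋₊ with hN
  set L := (2 * c + 3) * ρ with hL
  have hAρ : 1 ≤ A / ρ := by rw [le_div_iff₀ (by linarith)]; linarith
  choose q hq using fun ab : ℕ × ℕ => h.near ((L * ab.1) • f1 + (L * ab.2) • f2)
  have hNA : (N : ℝ) ≤ A / ρ := Nat.floor_le (by linarith)
  have hNA' : (N : ℝ) * ρ ≤ A := by rwa [le_div_iff₀ (by linarith)] at hNA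
  have hN1 : (1 : ℝ) ≤ N := by
    have : 1 ≤ N := Nat.le_floor (by simpa using hAρ)
    exact_mod_cast this
  have hN2 : A / ρ ≤ 2 * N := by
    have := Nat.lt_floor_add_one (A / ρ)
    rw [← hN] at this
    linarith
  have e11 : inner ℝ f1 f1 = (1 : ℝ) := by rw [real_inner_self_eq_norm_sq, h1]; norm_num
  have e22 : inner ℝ f2 f2 = (1 : ℝ) := by rw [real_inner_self_eq_norm_sq, h2]; norm_num
  have h21 : inner ℝ f2 f1 = (0 : ℝ) := by rw [real_inner_comm]; exact h12
  have hq1 : ∀ ab, |L * ab.1 - inner ℝ f1 (φ (q ab))| ≤ c := by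
    intro ab
    have := abs_real_inner_le_norm f1 ((L * ab.1) • f1 + (L * ab.2) • f2 - φ (q ab))
    rw [inner_sub_right, inner_add_right, inner_smul_right, inner_smul_right, e11, h12, h1] at this
    simp only [mul_one, mul_zero, add_zero, one_mul] at this
    exact this.trans (hq ab)
  have hq2 : ∀ ab, |L * ab.2 - inner ℝ f2 (φ (q ab))| ≤ c := by
    intro ab
    have := abs_real_inner_le_norm f2 ((L * ab.1) • f1 + (L * ab.2) • f2 - φ (q ab))
    rw [inner_sub_right, inner_add_right, inner_smul_right, inner_smul_right, e22, h21, h2] at this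
    simp only [mul_one, mul_zero, zero_add, one_mul] at this
    exact this.trans (hq ab)
  have sep : ∀ a b : ℕ, |L * a - L * b| ≤ 2 * c + 2 * ρ → a = b := by
    intro a b hab
    by_contra hne
    have h3 : (1 : ℝ) ≤ |(a : ℝ) - b| := by
      have h4 : (1 : ℤ) ≤ |(a : ℤ) - b| := Int.one_le_abs (by omega)
      exact_mod_cast h4
    rw [← mul_sub, abs_mul, abs_of_pos (by positivity)] at hab
    have : L ≤ L * |(a : ℝ) - b| := le_mul_of_one_le_right (by positivity) h3
    nlinarith
  let F : (Fin d → ℤ) × (ℕ × ℕ) → (Fin d → ℤ) := fun x => x.1 + q x.2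
  let S := T ×ˢ (Finset.range N ×ˢ Finset.range N)
  have hinj : Set.InjOn F S := by
    rintro ⟨m, ab⟩ hm ⟨m', ab'⟩ hm' heq
    simp only [S, Finset.coe_product, Set.mem_prod, Finset.mem_coe] at hm hm'
    have heq' : m + q ab = m' + q ab' := heq
    have e : φ m + φ (q ab) = φ m' + φ (q ab') := by rw [← map_add, ← map_add, heq']
    have i1 : inner ℝ f1 (φ m) + inner ℝ f1 (φ (q ab)) = inner ℝ f1 (φ m') + inner ℝ f1 (φ (q ab')) := by
      rw [← inner_add_right, ← inner_add_right, e]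
    have i2 : inner ℝ f2 (φ m) + inner ℝ f2 (φ (q ab)) = inner ℝ f2 (φ m') + inner ℝ f2 (φ (q ab')) := by
      rw [← inner_add_right, ← inner_add_right, e]
    have a1 : ab.1 = ab'.1 := by
      apply sep
      have := abs_le.mp (hq1 ab); have := abs_le.mp (hq1 ab')
      have := abs_le.mp (hf1 m hm.1); have := abs_le.mp (hf1 m' hm'.1)
      rw [abs_le]; constructor <;> linarith
    have a2 : ab.2 = ab'.2 := by
      apply sep
      have := abs_le.mp (hq2 ab); have := abs_le.mp (hq2 ab')
      have := abs_le.mp (hf2 m hm.1); have := abs_le.mp (hf2 m' hm'.1)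
      rw [abs_le]; constructor <;> linarith
    have a3 : ab = ab' := Prod.ext a1 a2
    subst a3
    simpa using heq'
  have hcard := Finset.card_image_of_injOn hinj
  have hb := ball_count h (13 * c * A) (by nlinarith) (S.image F) (by
    intro m hm
    rw [Finset.mem_image] at hm
    obtain ⟨⟨m', ab⟩, hm', rfl⟩ := hm
    simp only [S, Finset.mem_product, Finset.mem_range] at hm'
    have n1 := hT m' hm'.1
    have l1 : (ab.1 : ℝ) ≤ N := by exact_mod_cast hm'.2.1.le
    have l2 : (ab.2 : ℝ) ≤ N := by exact_mod_cast hm'.2.2.le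
    have n2 : ‖φ (q ab)‖ ≤ L * N + L * N + c := by
      have e : φ (q ab) = (L * ab.1) • f1 + (L * ab.2) • f2 - ((L * ab.1) • f1 + (L * ab.2) • f2 - φ (q ab)) := by abel
      rw [e]
      refine (norm_sub_le _ _).trans (add_le_add ((norm_add_le _ _).trans ?_) (hq ab))
      rw [norm_smul, norm_smul, h1, h2, Real.norm_of_nonneg (by positivity), Real.norm_of_nonneg (by positivity)]
      simp only [mul_one]
      gcongr
    show ‖φ (m' + q ab)‖ ≤ _
    rw [map_add]
    refine (norm_add_le _ _).trans ((add_le_add n1 n2).trans ?_)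
    have : L * N ≤ (2 * c + 3) * A := by
      rw [hL, mul_assoc, mul_comm ρ]; gcongr
    nlinarith)
  rw [hcard] at hb
  simp only [S, Finset.card_product, Finset.card_range] at hb
  push_cast at hb
  have e : (3 * c * (13 * c * A)) ^ d = (3 * c * (13 * c)) ^ d * A ^ d := by rw [← mul_pow]; ring_nf
  rw [e] at hb
  have : (A / ρ) ^ 2 ≤ 4 * (N * N) := by nlinarith
  calc (T.card : ℝ) * (A / ρ) ^ 2 ≤ T.card * (4 * (N * N)) := by gcongr
    _ = 4 * (T.card * (N * N)) := by ring
    _ ≤ 4 * ((3 * c * (13 * c)) ^ d * A ^ d) := by gcongr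
    _ = _ := by ring


theorem slab_count' {d : ℕ} (hd : 2 ≤ d) {c : ℝ} {φ : (Fin d → ℤ) →+ EuclideanSpace ℝ (Fin d)} (h : LatD d c φ)
    (f1 f2 : EuclideanSpace ℝ (Fin d)) (h1 : ‖f1‖ = 1) (h2 : ‖f2‖ = 1) (h12 : inner ℝ f1 f2 = 0)
    (A ρ : ℝ) (hρ : 1 ≤ ρ) (hA : ρ ≤ A) (T : Finset (Fin d → ℤ)) (hT : ∀ m ∈ T, ‖φ m‖ ≤ A)
    (hf1 : ∀ m ∈ T, |inner ℝ f1 (φ m)| ≤ ρ) (hf2 : ∀ m ∈ T, |inner ℝ f2 (φ m)| ≤ ρ) :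
    (T.card : ℝ) ≤ 4 * (3 * c * (13 * c)) ^ d * A ^ (d - 2) * ρ ^ 2 := by
  have := slab_count h f1 f2 h1 h2 h12 A ρ hρ hA T hT hf1 hf2
  have hA0 : 0 < A := by linarith
  have e : A ^ d = A ^ (d - 2) * A ^ 2 := by rw [← pow_add]; congr 1; omega
  rw [e, div_pow, ← mul_div_assoc, div_le_iff₀ (by positivity)] at this
  have h3 : (T.card : ℝ) * A ^ 2 ≤ (4 * (3 * c * (13 * c)) ^ d * A ^ (d - 2) * ρ ^ 2) * A ^ 2 := by linarith
  exact le_of_mul_le_mul_right h3 (by positivity)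

/-- projection data -/
structure ProjD {d : ℕ} (φ : (Fin d → ℤ) →+ EuclideanSpace ℝ (Fin d)) (p : ℕ) (w : Fin p → (Fin d → ℤ))
    (P : EuclideanSpace ℝ (Fin d) →ₗ[ℝ] EuclideanSpace ℝ (Fin d))
    (f1 f2 : EuclideanSpace ℝ (Fin d)) : Prop where
  comb : ∀ x, ∃ a : Fin p → ℝ, x - P x = ∑ i, a i • φ (w i)
  zero : ∀ i, P (φ (w i)) = 0
  le : ∀ x, ‖P x‖ ≤ ‖x‖
  n1 : ‖f1‖ = 1
  n2 : ‖f2‖ = 1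
  orth : inner ℝ f1 f2 = (0 : ℝ)
  i1 : ∀ x, inner ℝ f1 x = (inner ℝ f1 (P x) : ℝ)
  i2 : ∀ x, inner ℝ f2 x = (inner ℝ f2 (P x) : ℝ)

theorem near_count {d : ℕ} (hd : 2 ≤ d) {c : ℝ} {φ : (Fin d → ℤ) →+ EuclideanSpace ℝ (Fin d)} (h : LatD d c φ)
    {p : ℕ} {w : Fin p → (Fin d → ℤ)} {P : EuclideanSpace ℝ (Fin d) →ₗ[ℝ] EuclideanSpace ℝ (Fin d)}
    {f1 f2 : EuclideanSpace ℝ (Fin d)} (H : ProjD φ p w P f1 f2)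
    (A ρ : ℝ) (hA : 1 ≤ A) (hw : ∀ i, ‖φ (w i)‖ ≤ A) (hρ0 : 0 < ρ) (hρ : ρ ≤ 1)
    (T : Finset (Fin d → ℤ)) (hT : ∀ m ∈ T, ‖φ m‖ ≤ A)
    (hT0 : ∀ m ∈ T, 0 < ‖P (φ m)‖) (hT1 : ∀ m ∈ T, ‖P (φ m)‖ ≤ ρ) :
    (T.card : ℝ) ≤ 128 * (3 * c * (13 * c)) ^ d * (p + 4) ^ (d - 2) * A ^ (d - 2) * ρ := by
  have hc := h.one_le
  rcases T.eq_empty_or_nonempty with rfl | hne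
  · simp; positivity
  obtain ⟨m0, hm0, hmax⟩ := T.exists_max_image (fun m => ‖P (φ m)‖) hne
  have hρ1 : 1 ≤ 1 / ρ := by rw [le_div_iff₀ hρ0]; linarith
  set N := ⌊1 / ρ⌋₊ with hN
  have hNA : (N : ℝ) ≤ 1 / ρ := Nat.floor_le (by linarith)
  have hNA' : (N : ℝ) * ρ ≤ 1 := by rwa [le_div_iff₀ (by linarith)] at hNA
  have hN1 : (1 : ℝ) ≤ N := by
    have : 1 ≤ N := Nat.le_floor (by simpa using hρ1)
    exact_mod_cast this
  have hN2 : 1 / ρ ≤ 2 * N := by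
    have := Nat.lt_floor_add_one (1 / ρ)
    rw [← hN] at this
    linarith
  have hex : ∀ j : ℕ, ∃ q : Fin d → ℤ, P (φ q) = (3 * j : ℝ) • P (φ m0) ∧
      ‖φ q‖ ≤ 3 * j * ‖P (φ m0)‖ + p * A := by
    intro j
    obtain ⟨a, ha⟩ := H.comb ((3 * j : ℝ) • φ m0)
    have e3 : φ ((3 * j : ℕ) • m0) = (3 * j : ℝ) • φ m0 := by
      rw [map_nsmul, ← Nat.cast_smul_eq_nsmul ℝ]; push_cast; rfl
    have eq1 : φ ((3 * j : ℕ) • m0 - ∑ i, ⌊a i⌋ • w i) = (3 * j : ℝ) • φ m0 - ∑ i, (⌊a i⌋ : ℝ) • φ (w i) := by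
      rw [map_sub, e3, map_sum]
      congr 1
      refine Finset.sum_congr rfl fun i _ => ?_
      rw [map_zsmul, Int.cast_smul_eq_zsmul]
    refine ⟨(3 * j : ℕ) • m0 - ∑ i, ⌊a i⌋ • w i, ?_, ?_⟩
    · rw [eq1, map_sub, map_sum, map_smul]
      simp [H.zero]
    · have eq2 : (3 * j : ℝ) • φ m0 - ∑ i, (⌊a i⌋ : ℝ) • φ (w i) =
          (3 * j : ℝ) • P (φ m0) + ∑ i, (Int.fract (a i)) • φ (w i) := by
        have : (3 * j : ℝ) • φ m0 = (3 * j : ℝ) • P (φ m0) + ∑ i, a i • φ (w i) := by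
          rw [← ha, map_smul]; abel
        rw [this, add_sub_assoc, ← Finset.sum_sub_distrib]
        congr 1
        refine Finset.sum_congr rfl fun i _ => ?_
        rw [← sub_smul]; rfl
      rw [eq1, eq2]
      refine (norm_add_le _ _).trans (add_le_add ?_ ?_)
      · rw [norm_smul, Real.norm_of_nonneg (by positivity)]
      · refine (norm_sum_le _ _).trans ?_
        have : ∀ i ∈ Finset.univ, ‖Int.fract (a i) • φ (w i)‖ ≤ A := by
          intro i _
          rw [norm_smul, Real.norm_of_nonneg (Int.fract_nonneg _)]
          have := (Int.fract_lt_one (a i)).le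
          have := Int.fract_nonneg (a i)
          have := hw i
          have := norm_nonneg (φ (w i))
          nlinarith
        refine (Finset.sum_le_card_nsmul _ _ _ this).trans ?_
        simp
  choose q hq1 hq2 using hex
  let F : (Fin d → ℤ) × ℕ → (Fin d → ℤ) := fun x => x.1 + q x.2
  let S := T ×ˢ Finset.range N
  have hpos := hT0 m0 hm0
  have hinj : Set.InjOn F S := by
    rintro ⟨m, j⟩ hm ⟨m', j'⟩ hm' heq
    simp only [S, Finset.coe_product, Set.mem_prod, Finset.mem_coe] at hm hm'
    have heq' : m + q j = m' + q j' := heq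
    have e : P (φ m) + P (φ (q j)) = P (φ m') + P (φ (q j')) := by
      rw [← map_add, ← map_add, ← map_add, ← map_add, heq']
    rw [hq1, hq1] at e
    have e2 : (3 * j - 3 * j' : ℝ) • P (φ m0) = P (φ m') - P (φ m) := by
      rw [sub_smul, sub_eq_sub_iff_add_eq_add, add_comm, e, add_comm]
    have e3 : |(3 * j - 3 * j' : ℝ)| * ‖P (φ m0)‖ ≤ 2 * ‖P (φ m0)‖ := by
      rw [← Real.norm_eq_abs, ← norm_smul, e2]
      refine (norm_sub_le _ _).trans ?_
      have := hmax m hm.1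
      have := hmax m' hm'.1
      linarith
    have e4 := le_of_mul_le_mul_right e3 hpos
    have e5 : j = j' := by
      have : |(3 * j - 3 * j' : ℤ)| ≤ 2 := by exact_mod_cast e4
      rw [abs_le] at this
      omega
    subst e5
    simpa using heq'
  have hcard := Finset.card_image_of_injOn hinj
  have hm0ρ := hT1 m0 hm0
  have hj : ∀ j < N, 3 * (j : ℝ) * ‖P (φ m0)‖ ≤ 3 := by
    intro j hj
    have : (j : ℝ) ≤ N := by exact_mod_cast hj.le
    have : (j : ℝ) * ‖P (φ m0)‖ ≤ N * ρ := by gcongr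
    linarith
  have hPb : ∀ m ∈ S.image F, ‖P (φ m)‖ ≤ 4 := by
    intro m hm
    rw [Finset.mem_image] at hm
    obtain ⟨⟨m', j⟩, hm', rfl⟩ := hm
    simp only [S, Finset.mem_product, Finset.mem_range] at hm'
    show ‖P (φ (m' + q j))‖ ≤ _
    rw [map_add, map_add, hq1]
    refine (norm_add_le _ _).trans ?_
    rw [norm_smul, Real.norm_of_nonneg (by positivity)]
    have := hT1 m' hm'.1
    have := hj j hm'.2
    linarith
  have hb := slab_count' hd h f1 f2 H.n1 H.n2 H.orth ((p + 4) * A) 4 (by norm_num) (by nlinarith [(Nat.cast_nonneg p : (0:ℝ) ≤ p)])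
    (S.image F) (by
    intro m hm
    rw [Finset.mem_image] at hm
    obtain ⟨⟨m', j⟩, hm', rfl⟩ := hm
    simp only [S, Finset.mem_product, Finset.mem_range] at hm'
    show ‖φ (m' + q j)‖ ≤ _
    rw [map_add]
    refine (norm_add_le _ _).trans ?_
    have := hT m' hm'.1
    have := hq2 j
    have := hj j hm'.2
    linarith) (by
      intro m hm
      rw [H.i1]
      refine (abs_real_inner_le_norm _ _).trans ?_
      rw [H.n1, one_mul]; exact hPb m hm) (by
      intro m hm
      rw [H.i2]
      refine (abs_real_inner_le_norm _ _).trans ?_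
      rw [H.n2, one_mul]; exact hPb m hm)
  rw [hcard] at hb
  simp only [S, Finset.card_product, Finset.card_range] at hb
  push_cast at hb
  rw [mul_pow ((p : ℝ) + 4)] at hb
  have h1 : 1 ≤ 2 * (N * ρ) := by
    rw [div_le_iff₀ hρ0] at hN2; linarith
  calc (T.card : ℝ) ≤ T.card * (2 * (N * ρ)) := le_mul_of_one_le_right (by positivity) h1
    _ = (T.card * N) * (2 * ρ) := by ring
    _ ≤ (4 * (3 * c * (13 * c)) ^ d * ((p + 4) ^ (d - 2) * A ^ (d - 2)) * 4 ^ 2) * (2 * ρ) := by gcongr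
    _ = _ := by ring

/-- sum over dyadic pieces -/
theorem sum_inv {ι : Type*} (T : Finset ι) (D : ι → ℝ) (hD : ∀ i ∈ T, 0 < D i) (n : ℕ) (A B : ℝ)
    (hB : 1 ≤ B) (hA : 1 ≤ A)
    (hDA : ∀ i ∈ T, D i ≤ A)
    (hs : ∀ ρ, 0 < ρ → ρ ≤ 1 → ((T.filter (fun i => D i ≤ ρ)).card : ℝ) ≤ B * A ^ n * ρ)
    (hl : ∀ ρ, 1 ≤ ρ → ρ ≤ 2 * A → ((T.filter (fun i => D i ≤ ρ)).card : ℝ) ≤ B * A ^ n * ρ ^ 2) :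
    ∑ i ∈ T, 1 / D i ≤ (4 * (2 * B + n + 2) * B + 8 * B) * A ^ (n + 1) := by
  have hA0 : 0 < A := by linarith
  have hB0 : 0 < B := by linarith
  rw [← Finset.sum_filter_add_sum_filter_not T (fun i => D i ≤ 1)]
  have key1 : ∑ i ∈ T.filter (fun i => D i ≤ 1), 1 / D i ≤ 4 * (2 * B + n + 2) * B * A ^ (n + 1) := by
    have hex : ∀ i : ι, ∃ k : ℕ, i ∈ T.filter (fun i => D i ≤ 1) → (2 : ℝ) ^ k ≤ 1 / D i ∧ 1 / D i < 2 ^ (k + 1) := by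
      intro i
      by_cases hi : i ∈ T.filter (fun i => D i ≤ 1)
      · rw [Finset.mem_filter] at hi
        obtain ⟨k, hk⟩ := exists_nat_pow_near (x := 1 / D i) (y := (2 : ℝ))
          (by rw [le_div_iff₀ (hD i hi.1)]; linarith) (by norm_num)
        exact ⟨k, fun _ => hk⟩
      · exact ⟨0, fun h => absurd h hi⟩
    choose k hk using hex
    set K := ⌊2 * (B + (n : ℝ) * A)⌋₊ with hK
    have hkK : ∀ i ∈ T.filter (fun i => D i ≤ 1), k i ∈ Finset.range (K + 1) := by
      intro i hi
      have hi' := Finset.mem_filter.mp hi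
      have h1 := (hk i hi).1
      have hDi := hD i hi'.1
      have h2 : 1 ≤ B * A ^ n * D i := by
        refine le_trans ?_ (hs (D i) hDi hi'.2)
        have : 0 < (T.filter (fun j => D j ≤ D i)).card := Finset.card_pos.mpr ⟨i, by simp [hi'.1]⟩
        exact_mod_cast this
      have h3 : (2 : ℝ) ^ k i ≤ B * A ^ n := h1.trans (by rw [div_le_iff₀ hDi]; exact h2)
      have h4 := Real.log_le_log (by positivity) h3
      rw [Real.log_mul (by positivity) (by positivity), Real.log_pow, Real.log_pow] at h4
      have h5 := Real.log_two_gt_d9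
      have h6 : Real.log B ≤ B := (Real.log_le_sub_one_of_pos hB0).trans (by linarith)
      have h7 : Real.log A ≤ A := (Real.log_le_sub_one_of_pos hA0).trans (by linarith)
      have h8 : (n : ℝ) * Real.log A ≤ n * A := by gcongr
      have h9 : (k i : ℝ) ≤ 2 * (B + n * A) := by
        have : (0 : ℝ) ≤ k i := by positivity
        nlinarith
      rw [Finset.mem_range, Nat.lt_succ_iff]
      exact Nat.le_floor h9
    rw [← Finset.sum_fiberwise_of_maps_to hkK]
    have hterm : ∀ j ∈ Finset.range (K + 1),
        ∑ i ∈ (T.filter (fun i => D i ≤ 1)).filter (fun i => k i = j), 1 / D i ≤ 2 * (B * A ^ n) := by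
      intro j _
      have h1 : ∀ i ∈ (T.filter (fun i => D i ≤ 1)).filter (fun i => k i = j), 1 / D i ≤ 2 ^ (j + 1) := by
        intro i hi
        rw [Finset.mem_filter] at hi
        have := (hk i hi.1).2
        rw [hi.2] at this
        exact this.le
      refine (Finset.sum_le_card_nsmul _ _ _ h1).trans ?_
      rw [nsmul_eq_mul]
      have h2 : (((T.filter (fun i => D i ≤ 1)).filter (fun i => k i = j)).card : ℝ) ≤ B * A ^ n * ((1 / 2) ^ j) := by
        refine le_trans ?_ (hs ((1 / 2) ^ j) (by positivity) (pow_le_one₀ (by norm_num) (by norm_num)))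
        have : (T.filter (fun i => D i ≤ 1)).filter (fun i => k i = j) ⊆ T.filter (fun i => D i ≤ (1 / 2) ^ j) := by
          intro i hi
          rw [Finset.mem_filter] at hi
          have h3 := (hk i hi.1).1
          rw [hi.2] at h3
          have hiT := (Finset.mem_filter.mp hi.1).1
          rw [Finset.mem_filter]
          refine ⟨hiT, ?_⟩
          rw [div_pow, one_pow, le_div_iff₀ (by positivity)]
          rw [le_div_iff₀ (hD i hiT)] at h3
          linarith
        exact_mod_cast Finset.card_le_card this
      calc _ ≤ B * A ^ n * ((1 / 2) ^ j) * 2 ^ (j + 1) := by gcongr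
        _ = 2 * (B * A ^ n) * ((1 / 2) ^ j * 2 ^ j) := by ring
        _ = _ := by rw [← mul_pow]; norm_num
    refine (Finset.sum_le_card_nsmul _ _ _ hterm).trans ?_
    rw [nsmul_eq_mul, Finset.card_range]
    have hKr : (K : ℝ) ≤ 2 * (B + n * A) := Nat.floor_le (by positivity)
    have : ((K + 1 : ℕ) : ℝ) ≤ 2 * (2 * B + n + 2) * A := by
      push_cast
      nlinarith
    calc _ ≤ (2 * (2 * B + n + 2) * A) * (2 * (B * A ^ n)) := by gcongr
      _ = _ := by ring
  have key2 : ∑ i ∈ T.filter (fun i => ¬ D i ≤ 1), 1 / D i ≤ 8 * B * A ^ (n + 1) := by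
    have hex : ∀ i : ι, ∃ k : ℕ, i ∈ T.filter (fun i => ¬ D i ≤ 1) → (2 : ℝ) ^ k ≤ D i ∧ D i < 2 ^ (k + 1) := by
      intro i
      by_cases hi : i ∈ T.filter (fun i => ¬ D i ≤ 1)
      · rw [Finset.mem_filter] at hi
        obtain ⟨k, hk⟩ := exists_nat_pow_near (x := D i) (y := (2 : ℝ))
          (by linarith [hi.2]) (by norm_num)
        exact ⟨k, fun _ => hk⟩
      · exact ⟨0, fun h => absurd h hi⟩
    choose k hk using hex
    obtain ⟨K, hK1, hK2⟩ := exists_nat_pow_near (x := A) (y := (2 : ℝ)) hA (by norm_num)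
    have hkK : ∀ i ∈ T.filter (fun i => ¬ D i ≤ 1), k i ∈ Finset.range (K + 1) := by
      intro i hi
      have hi' := Finset.mem_filter.mp hi
      have h1 := (hk i hi).1
      have h2 : (2 : ℝ) ^ k i < 2 ^ (K + 1) := (h1.trans (hDA i hi'.1)).trans_lt hK2
      rw [Finset.mem_range]
      exact (pow_lt_pow_iff_right₀ (by norm_num)).mp h2
    rw [← Finset.sum_fiberwise_of_maps_to hkK]
    have hterm : ∀ j ∈ Finset.range (K + 1),
        ∑ i ∈ (T.filter (fun i => ¬ D i ≤ 1)).filter (fun i => k i = j), 1 / D i ≤ 4 * (B * A ^ n) * 2 ^ j := by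
      intro j hj
      have hj' : (2 : ℝ) ^ j ≤ 2 ^ K := pow_le_pow_right₀ (by norm_num) (by rw [Finset.mem_range] at hj; omega)
      have h1 : ∀ i ∈ (T.filter (fun i => ¬ D i ≤ 1)).filter (fun i => k i = j), 1 / D i ≤ (1 / 2) ^ j := by
        intro i hi
        rw [Finset.mem_filter] at hi
        have := (hk i hi.1).1
        rw [hi.2] at this
        rw [div_pow, one_pow]
        exact one_div_le_one_div_of_le (by positivity) this
      refine (Finset.sum_le_card_nsmul _ _ _ h1).trans ?_
      rw [nsmul_eq_mul]
      have h2 : (((T.filter (fun i => ¬ D i ≤ 1)).filter (fun i => k i = j)).card : ℝ) ≤ B * A ^ n * (2 ^ (j + 1)) ^ 2 := by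
        refine le_trans ?_ (hl (2 ^ (j + 1)) (one_le_pow₀ (by norm_num)) (by rw [pow_succ]; linarith))
        have : (T.filter (fun i => ¬ D i ≤ 1)).filter (fun i => k i = j) ⊆ T.filter (fun i => D i ≤ 2 ^ (j + 1)) := by
          intro i hi
          rw [Finset.mem_filter] at hi
          have h3 := (hk i hi.1).2
          rw [hi.2] at h3
          have hiT := (Finset.mem_filter.mp hi.1).1
          rw [Finset.mem_filter]
          exact ⟨hiT, h3.le⟩
        exact_mod_cast Finset.card_le_card this
      calc _ ≤ B * A ^ n * (2 ^ (j + 1)) ^ 2 * (1 / 2) ^ j := by gcongr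
        _ = 4 * (B * A ^ n) * 2 ^ j * ((1 / 2) ^ j * 2 ^ j) := by ring
        _ = _ := by rw [← mul_pow]; norm_num
    refine (Finset.sum_le_sum hterm).trans ?_
    rw [← Finset.mul_sum]
    have h3 : ∑ i ∈ Finset.range (K + 1), (2 : ℝ) ^ i ≤ 2 * A := by
      rw [geom_sum_eq (by norm_num)]
      rw [pow_succ]
      linarith
    calc _ ≤ 4 * (B * A ^ n) * (2 * A) := by gcongr
      _ = _ := by ring
  linarith


/-- orthogonal projection off the span of `w` -/
def PW {d p : ℕ} (w : Fin p → EuclideanSpace ℝ (Fin d)) :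
    EuclideanSpace ℝ (Fin d) →ₗ[ℝ] EuclideanSpace ℝ (Fin d) :=
  ((Submodule.span ℝ (Set.range w))ᗮ.starProjection : EuclideanSpace ℝ (Fin d) →L[ℝ] EuclideanSpace ℝ (Fin d)).toLinearMap

theorem PW_eq_zero {d p : ℕ} (w : Fin p → EuclideanSpace ℝ (Fin d)) (x) :
    PW w x = 0 ↔ x ∈ Submodule.span ℝ (Set.range w) := by
  show (Submodule.span ℝ (Set.range w))ᗮ.starProjection x = 0 ↔ _
  rw [Submodule.starProjection_apply_eq_zero_iff, Submodule.orthogonal_orthogonal]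

theorem PW_mem {d p : ℕ} (w : Fin p → EuclideanSpace ℝ (Fin d)) (x) :
    PW w x ∈ (Submodule.span ℝ (Set.range w))ᗮ := Submodule.starProjection_apply_mem _ _

theorem sub_PW_mem {d p : ℕ} (w : Fin p → EuclideanSpace ℝ (Fin d)) (x) :
    x - PW w x ∈ Submodule.span ℝ (Set.range w) := by
  have := Submodule.sub_starProjection_mem_orthogonal (K := (Submodule.span ℝ (Set.range w))ᗮ) x
  rwa [Submodule.orthogonal_orthogonal] at this

theorem inner_PW_self {d p : ℕ} (w : Fin p → EuclideanSpace ℝ (Fin d)) (x) :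
    inner ℝ x (PW w x) = ‖PW w x‖ ^ 2 := by
  have h : inner ℝ (x - PW w x) (PW w x) = (0 : ℝ) :=
    (Submodule.mem_orthogonal _ _).mp (PW_mem w x) _ (sub_PW_mem w x)
  rw [inner_sub_left, real_inner_self_eq_norm_sq] at h
  linarith

theorem exists_projD {d : ℕ} (φ : (Fin d → ℤ) →+ EuclideanSpace ℝ (Fin d)) {p : ℕ} (hp : p + 2 ≤ d)
    (w : Fin p → (Fin d → ℤ)) : ∃ f1 f2, ProjD φ p w (PW (fun i => φ (w i))) f1 f2 := by
  set W := Submodule.span ℝ (Set.range (fun i => φ (w i))) with hW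
  have hfr : Module.finrank ℝ W ≤ p := by
    have := finrank_range_le_card (R := ℝ) (fun i => φ (w i))
    rw [Fintype.card_fin] at this
    exact this
  have h2 : 2 ≤ Module.finrank ℝ Wᗮ := by
    have := Submodule.finrank_add_finrank_orthogonal W
    rw [finrank_euclideanSpace_fin] at this
    omega
  let b := stdOrthonormalBasis ℝ Wᗮ
  have hi : ∀ (f : Wᗮ) (x), inner ℝ (f : EuclideanSpace ℝ (Fin d)) x =
      (inner ℝ (f : EuclideanSpace ℝ (Fin d)) (PW (fun i => φ (w i)) x) : ℝ) := by
    intro f x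
    have h : inner ℝ (x - PW (fun i => φ (w i)) x) (f : EuclideanSpace ℝ (Fin d)) = (0 : ℝ) :=
      (Submodule.mem_orthogonal _ _).mp f.2 _ (sub_PW_mem (fun i => φ (w i)) x)
    rw [real_inner_comm, inner_sub_right] at h
    linarith
  refine ⟨b ⟨0, by omega⟩, b ⟨1, by omega⟩, ?_, ?_, ?_, ?_, ?_, ?_, hi _, hi _⟩
  · intro x
    obtain ⟨a, ha⟩ := (Submodule.mem_span_range_iff_exists_fun ℝ).mp (sub_PW_mem (fun i => φ (w i)) x)
    exact ⟨a, ha.symm⟩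
  · intro i
    rw [PW_eq_zero]
    exact Submodule.subset_span ⟨i, rfl⟩
  · intro x
    exact Submodule.norm_starProjection_apply_le _ _
  · rw [← Submodule.coe_norm]; exact b.norm_eq_one _
  · rw [← Submodule.coe_norm]; exact b.norm_eq_one _
  · rw [← Submodule.coe_inner]
    exact b.orthonormal.2 (by simp)

theorem step_sum {d : ℕ} (hd : 2 ≤ d) {c : ℝ} {φ : (Fin d → ℤ) →+ EuclideanSpace ℝ (Fin d)} (h : LatD d c φ) :
    ∃ C : ℝ, 0 < C ∧ ∀ (p : ℕ), p + 2 ≤ d → ∀ (w : Fin p → (Fin d → ℤ)) (A : ℝ), 1 ≤ A →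
      (∀ i, ‖φ (w i)‖ ≤ A) → ∀ T : Finset (Fin d → ℤ), (∀ m ∈ T, ‖φ m‖ ≤ A) →
      (∀ m ∈ T, φ m ∉ Submodule.span ℝ (Set.range (fun i => φ (w i)))) →
      ∑ m ∈ T, 1 / ‖PW (fun i => φ (w i)) (φ m)‖ ≤ C * A ^ (d - 1) := by
  have hc := h.one_le
  set Q := (3 * c * (13 * c)) ^ d with hQ
  have hQ1 : 1 ≤ Q := one_le_pow₀ (by nlinarith)
  set B := 128 * Q * ((d : ℝ) + 4) ^ (d - 2) with hB
  have hD1 : 1 ≤ ((d : ℝ) + 4) ^ (d - 2) := one_le_pow₀ (by linarith [(Nat.cast_nonneg d : (0:ℝ) ≤ d)])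
  have hB1 : 1 ≤ B := by nlinarith
  refine ⟨4 * (2 * B + (d - 2 : ℕ) + 2) * B + 8 * B, by positivity, ?_⟩
  intro p hp w A hA hw T hT hTW
  obtain ⟨f1, f2, H⟩ := exists_projD φ hp w
  set P := PW (fun i => φ (w i)) with hP
  have hpos : ∀ m ∈ T, 0 < ‖P (φ m)‖ := by
    intro m hm
    rw [norm_pos_iff]
    intro h0
    exact hTW m hm ((PW_eq_zero _ _).mp h0)
  have hpd : (p : ℝ) ≤ d := by exact_mod_cast (by omega : p ≤ d)
  have e : d - 1 = (d - 2) + 1 := by omega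
  rw [e]
  refine sum_inv T (fun m => ‖P (φ m)‖) hpos (d - 2) A B hB1 hA ?_ ?_ ?_
  · intro m hm
    exact (H.le _).trans (hT m hm)
  · intro ρ h0 h1
    refine (near_count hd h H A ρ hA hw h0 h1 _ (fun m hm => hT m (Finset.mem_filter.mp hm).1)
      (fun m hm => hpos m (Finset.mem_filter.mp hm).1) (fun m hm => (Finset.mem_filter.mp hm).2)).trans ?_
    rw [hB]
    gcongr
  · intro ρ h0 h1
    have hP1 : ∀ m ∈ T.filter (fun m => ‖P (φ m)‖ ≤ ρ), |inner ℝ f1 (φ m)| ≤ ρ := by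
      intro m hm
      rw [H.i1]
      refine (abs_real_inner_le_norm _ _).trans ?_
      rw [H.n1, one_mul]; exact (Finset.mem_filter.mp hm).2
    have hP2 : ∀ m ∈ T.filter (fun m => ‖P (φ m)‖ ≤ ρ), |inner ℝ f2 (φ m)| ≤ ρ := by
      intro m hm
      rw [H.i2]
      refine (abs_real_inner_le_norm _ _).trans ?_
      rw [H.n2, one_mul]; exact (Finset.mem_filter.mp hm).2
    refine (slab_count' hd h f1 f2 H.n1 H.n2 H.orth (2 * A) ρ h0 h1 _
      (fun m hm => (hT m (Finset.mem_filter.mp hm).1).trans (by linarith)) hP1 hP2).trans ?_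
    rw [← hQ, hB, mul_pow, ← mul_assoc]
    have : (2 : ℝ) ^ (d - 2) ≤ ((d : ℝ) + 4) ^ (d - 2) := by
      gcongr; linarith [(Nat.cast_nonneg d : (0:ℝ) ≤ d)]
    gcongr
    norm_num

theorem step_tsum {d : ℕ} (hd : 2 ≤ d) {c : ℝ} {φ : (Fin d → ℤ) →+ EuclideanSpace ℝ (Fin d)} (h : LatD d c φ) :
    ∃ C : ℝ, 0 < C ∧ ∀ (p : ℕ), p + 2 ≤ d → ∀ (w : Fin p → (Fin d → ℤ)) (A : ℝ), 1 ≤ A →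
      (∀ i, ‖φ (w i)‖ ≤ A) → 
      (∑' m : Fin d → ℤ, if ‖φ m‖ ≤ A ∧ φ m ∉ Submodule.span ℝ (Set.range (fun i => φ (w i))) then
        ENNReal.ofReal (1 / ‖PW (fun i => φ (w i)) (φ m)‖) else 0) ≤ ENNReal.ofReal (C * A ^ (d - 1)) := by
  obtain ⟨C, hC, hh⟩ := step_sum hd h
  refine ⟨C, hC, fun p hp w A hA hw => ?_⟩
  rw [ENNReal.tsum_eq_iSup_sum]
  refine iSup_le fun T => ?_
  rw [← Finset.sum_filter, ← ENNReal.ofReal_sum_of_nonneg (fun _ _ => by positivity)]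
  refine ENNReal.ofReal_le_ofReal (hh p hp w A hA hw _ ?_ ?_)
  · intro m hm; exact (Finset.mem_filter.mp hm).2.1
  · intro m hm; exact (Finset.mem_filter.mp hm).2.2

theorem slab_vol {d : ℕ} (S S' : Set (EuclideanSpace ℝ (Fin d))) (hS : MeasurableSet S) (hS' : MeasurableSet S')
    (x e : EuclideanSpace ℝ (Fin d)) (δ ρ : ℝ) (hρ : 0 < ρ) (hxe : inner ℝ x e = ρ)
    (hx : ∀ Y ∈ S, |inner ℝ x Y| ≤ δ) (hSS' : ∀ Y ∈ S, ∀ τ ∈ Set.Icc (0:ℝ) 1, Y + τ • e ∈ S') :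
    volume S ≤ ENNReal.ofReal (2 * δ / ρ) * volume S' := by
  have h1 : volume S = ∫⁻ τ in Set.Icc (0:ℝ) 1, ∫⁻ Y, S.indicator 1 (Y - τ • e) := by
    have : ∀ τ : ℝ, ∫⁻ Y, S.indicator 1 (Y - τ • e) = volume S := by
      intro τ
      rw [lintegral_sub_right_eq_self (fun Y => S.indicator (1 : EuclideanSpace ℝ (Fin d) → ENNReal) Y) (τ • e)]
      rw [lintegral_indicator_one hS]
    simp [this]
  have hm : Measurable (Function.uncurry fun (τ : ℝ) (Y : EuclideanSpace ℝ (Fin d)) =>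
      S.indicator (1 : EuclideanSpace ℝ (Fin d) → ENNReal) (Y - τ • e)) := by
    have : Measurable (S.indicator (1 : EuclideanSpace ℝ (Fin d) → ENNReal)) := measurable_one.indicator hS
    exact this.comp (by fun_prop)
  rw [h1, lintegral_lintegral_swap hm.aemeasurable]
  calc _ ≤ ∫⁻ Y, S'.indicator (fun _ => ENNReal.ofReal (2 * δ / ρ)) Y := by
        refine lintegral_mono fun Y => ?_
        by_cases hY : Y ∈ S'
        · rw [Set.indicator_of_mem hY]
          set I := Set.Icc ((inner ℝ x Y - δ) / ρ) ((inner ℝ x Y + δ) / ρ)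
          calc _ ≤ ∫⁻ τ in Set.Icc (0:ℝ) 1, I.indicator 1 τ := by
                refine lintegral_mono fun τ => ?_
                by_cases hz : Y - τ • e ∈ S
                · have hτ : τ ∈ I := by
                    have h2 := hx _ hz
                    rw [inner_sub_right, inner_smul_right, hxe, abs_le] at h2
                    constructor
                    · rw [div_le_iff₀ hρ]; linarith
                    · rw [le_div_iff₀ hρ]; linarith
                  rw [Set.indicator_of_mem hτ]
                  rw [Set.indicator_of_mem hz]
                  exact le_refl _
                · rw [Set.indicator_of_notMem hz]; exact zero_le
            _ ≤ ∫⁻ τ, I.indicator 1 τ := setLIntegral_le_lintegral _ _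
            _ = volume I := lintegral_indicator_one measurableSet_Icc
            _ = ENNReal.ofReal (2 * δ / ρ) := by
                rw [Real.volume_Icc]; congr 1; ring
        · rw [Set.indicator_of_notMem hY]
          refine le_of_eq ?_
          rw [setLIntegral_congr_fun (g := fun _ => 0) measurableSet_Icc]
          · simp
          · intro τ hτ
            refine Set.indicator_of_notMem (fun hz => hY ?_) _
            have := hSS' _ hz τ hτ
            simpa using this
    _ = _ := by rw [lintegral_indicator_const hS']


/-- slab region -/
def Sset {d s : ℕ} (x : Fin s → EuclideanSpace ℝ (Fin d)) (δ : Fin s → ℝ) (r : ℝ) :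
    Set (EuclideanSpace ℝ (Fin d)) := {Y | ‖Y‖ ≤ r ∧ ∀ j, |inner ℝ (x j) Y| ≤ δ j}

theorem Sset_meas {d s : ℕ} (x : Fin s → EuclideanSpace ℝ (Fin d)) (δ : Fin s → ℝ) (r : ℝ) :
    MeasurableSet (Sset x δ r) := by
  have : Sset x δ r = {Y | ‖Y‖ ≤ r} ∩ ⋂ j, {Y | |inner ℝ (x j) Y| ≤ δ j} := by
    ext Y; simp [Sset]
  rw [this]
  refine (IsClosed.measurableSet (isClosed_le (by fun_prop) (by fun_prop))).inter
    (MeasurableSet.iInter fun j => IsClosed.measurableSet (isClosed_le (by fun_prop) (by fun_prop)))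

/-- admissible tuples -/
def Adm {d s : ℕ} (φ : (Fin d → ℤ) →+ EuclideanSpace ℝ (Fin d)) (A : Fin s → ℝ) (m : Fin s → Fin d → ℤ) : Prop :=
  LinearIndependent ℝ (fun j => φ (m j)) ∧ ∀ j, ‖φ (m j)‖ ≤ A j

theorem Sset_step {d s : ℕ} (x : Fin s → EuclideanSpace ℝ (Fin d)) (z : EuclideanSpace ℝ (Fin d))
    (hz : z ∉ Submodule.span ℝ (Set.range x))
    (δ : Fin (s + 1) → ℝ) (hδ : 0 ≤ δ (Fin.last s)) (r : ℝ) (y : Fin (s + 1) → EuclideanSpace ℝ (Fin d))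
    (hy1 : ∀ j : Fin s, y j.castSucc = x j) (hy2 : y (Fin.last s) = z) :
    volume (Sset y δ r) ≤ ENNReal.ofReal (2 * δ (Fin.last s)) * ENNReal.ofReal (1 / ‖PW x z‖) *
      volume (Sset x (fun j => δ j.castSucc) (r + 1)) := by
  have hpos : 0 < ‖PW x z‖ := by
    rw [norm_pos_iff]; intro h0; exact hz ((PW_eq_zero _ _).mp h0)
  have := slab_vol (Sset y δ r) (Sset x (fun j => δ j.castSucc) (r + 1)) (Sset_meas _ _ _) (Sset_meas _ _ _)
    z ((1 / ‖PW x z‖) • PW x z) (δ (Fin.last s)) ‖PW x z‖ hpos (by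
      rw [inner_smul_right, inner_PW_self]; field_simp) (by
      intro Y hY
      have := hY.2 (Fin.last s)
      rwa [hy2] at this) (by
      intro Y hY τ hτ
      refine ⟨?_, fun j => ?_⟩
      · refine (norm_add_le _ _).trans (add_le_add hY.1 ?_)
        rw [norm_smul, norm_smul, Real.norm_of_nonneg hτ.1, Real.norm_of_nonneg (by positivity),
          one_div_mul_cancel hpos.ne', mul_one]
        exact hτ.2
      · have h1 := hY.2 j.castSucc
        rw [hy1] at h1
        have h2 : inner ℝ (x j) (PW x z) = (0 : ℝ) :=
          (Submodule.mem_orthogonal _ _).mp (PW_mem x z) _ (Submodule.subset_span ⟨j, rfl⟩)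
        rw [inner_add_right, inner_smul_right, inner_smul_right, h2]
        simpa using h1)
  refine this.trans (le_of_eq ?_)
  rw [← ENNReal.ofReal_mul (by positivity)]
  congr 2; ring

theorem tuple_sum {d : ℕ} (hd : 2 ≤ d) {c : ℝ} {φ : (Fin d → ℤ) →+ EuclideanSpace ℝ (Fin d)} (h : LatD d c φ)
    (κ : ℝ) (hκ : c ≤ κ) (s : ℕ) (hs : s + 1 ≤ d) : ∀ r : ℝ, ∃ C : ℝ, 0 < C ∧ ∀ δ A : Fin s → ℝ,
      (∀ j, 0 ≤ δ j) → (∀ j, 0 < A j) → (∀ i j, i ≤ j → A i ≤ κ * A j) →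
      (∑' m : Fin s → Fin d → ℤ, if Adm φ A m then volume (Sset (fun j => φ (m j)) δ r) else 0) ≤
        ENNReal.ofReal (C * ∏ j, (δ j * A j ^ (d - 1))) := by
  have hc := h.one_le
  have hκ1 : 1 ≤ κ := hc.trans hκ
  induction s with
  | zero =>
    intro r
    refine ⟨(volume (Metric.closedBall (0 : EuclideanSpace ℝ (Fin d)) r)).toReal + 1, by positivity, ?_⟩
    intro δ A _ _ _
    rw [tsum_fintype]
    simp only [Finset.univ_eq_empty, Finset.prod_empty, mul_one, Finset.univ_unique, Finset.sum_singleton]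
    have h1 : ∀ x : Fin 0 → EuclideanSpace ℝ (Fin d), volume (Sset x δ r) ≤
        volume (Metric.closedBall (0 : EuclideanSpace ℝ (Fin d)) r) :=
      fun x => measure_mono fun Y hY => by simpa using hY.1
    have h2 : volume (Metric.closedBall (0 : EuclideanSpace ℝ (Fin d)) r) ≠ ⊤ :=
      measure_closedBall_lt_top.ne
    refine le_trans (b := volume (Metric.closedBall (0 : EuclideanSpace ℝ (Fin d)) r)) ?_ ?_
    · split_ifs
      · exact h1 _
      · exact zero_le
    · rw [ENNReal.le_ofReal_iff_toReal_le h2 (by positivity)]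
      linarith
  | succ s ih =>
    intro r
    obtain ⟨C1, hC1, H1⟩ := ih (by omega) (r + 1)
    obtain ⟨C2, hC2, H2⟩ := step_tsum hd h
    refine ⟨C1 * (2 * C2 * κ ^ (d - 1)), by positivity, ?_⟩
    intro δ A hδ hA hmon
    have H1' := H1 (fun j => δ j.castSucc) (fun j => A j.castSucc) (fun j => hδ _) (fun j => hA _)
      (fun i j hij => hmon _ _ (by simpa using hij))
    set a := A (Fin.last s) with ha
    have ha0 : 0 < a := hA _
    set D := δ (Fin.last s) with hD
    have hD0 : 0 ≤ D := hδ _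
    set base : (Fin s → Fin d → ℤ) → ENNReal := fun m => if Adm φ (fun j => A j.castSucc) m then
      volume (Sset (fun j => φ (m j)) (fun j => δ j.castSucc) (r + 1)) else 0 with hbase
    rw [← (Fin.snocEquiv (fun _ : Fin (s + 1) => (Fin d → ℤ))).tsum_eq, ENNReal.tsum_prod', ENNReal.tsum_comm]
    have key : ∀ m : Fin s → Fin d → ℤ, (∑' z : Fin d → ℤ,
        if Adm φ A (Fin.snocEquiv (fun _ : Fin (s + 1) => (Fin d → ℤ)) (z, m)) then
          volume (Sset (fun j => φ (Fin.snocEquiv (fun _ : Fin (s + 1) => (Fin d → ℤ)) (z, m) j)) δ r) else 0) ≤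
        base m * ENNReal.ofReal (2 * D * (C2 * (κ * a) ^ (d - 1))) := by
      intro m
      have hadm : ∀ z, Adm φ A (Fin.snocEquiv (fun _ : Fin (s + 1) => (Fin d → ℤ)) (z, m)) →
          Adm φ (fun j => A j.castSucc) m ∧ ‖φ z‖ ≤ a ∧ φ z ∉ Submodule.span ℝ (Set.range (fun i => φ (m i))) := by
        intro z hz
        have hi := hz.1
        rw [linearIndependent_finSucc'] at hi
        have e1 : Fin.init (fun j => φ (Fin.snocEquiv (fun _ : Fin (s + 1) => (Fin d → ℤ)) (z, m) j)) = fun i => φ (m i) := by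
          funext i; simp [Fin.init, Fin.snocEquiv]
        rw [e1] at hi
        refine ⟨⟨hi.1, fun j => ?_⟩, ?_, ?_⟩
        · have := hz.2 j.castSucc
          simpa [Fin.snocEquiv] using this
        · have := hz.2 (Fin.last s)
          simpa [Fin.snocEquiv] using this
        · have := hi.2
          simpa [Fin.snocEquiv] using this
      by_cases hm : Adm φ (fun j => A j.castSucc) m
      · by_cases hbig : 1 ≤ κ * a
        · have H2' := H2 s (by omega) m (κ * a) hbig (fun i => (hm.2 i).trans (hmon _ _ (Fin.le_last _)))
          have hb : base m = volume (Sset (fun j => φ (m j)) (fun j => δ j.castSucc) (r + 1)) := if_pos hm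
          calc _ ≤ ∑' z : Fin d → ℤ, (base m * ENNReal.ofReal (2 * D)) * (if ‖φ z‖ ≤ κ * a ∧ φ z ∉ Submodule.span ℝ (Set.range (fun i => φ (m i))) then
                  ENNReal.ofReal (1 / ‖PW (fun i => φ (m i)) (φ z)‖) else 0) := by
                refine ENNReal.tsum_le_tsum fun z => ?_
                by_cases hz : Adm φ A (Fin.snocEquiv (fun _ : Fin (s + 1) => (Fin d → ℤ)) (z, m))
                · obtain ⟨_, hz1, hz2⟩ := hadm z hz
                  rw [if_pos hz, if_pos ⟨hz1.trans (by nlinarith), hz2⟩, hb]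
                  refine (Sset_step (fun j => φ (m j)) (φ z) hz2 δ hD0 r _ (fun j => by simp [Fin.snocEquiv])
                    (by simp [Fin.snocEquiv])).trans (le_of_eq ?_)
                  ring
                · rw [if_neg hz]; exact zero_le
            _ ≤ base m * ENNReal.ofReal (2 * D) * ENNReal.ofReal (C2 * (κ * a) ^ (d - 1)) := by
                rw [ENNReal.tsum_mul_left]
                gcongr
            _ = _ := by
                rw [mul_assoc, ← ENNReal.ofReal_mul (by positivity)]
        · refine le_trans (le_of_eq ?_) (zero_le)
          rw [ENNReal.tsum_eq_zero]
          intro z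
          refine if_neg fun hz => ?_
          obtain ⟨_, hz1, hz2⟩ := hadm z hz
          have : z = 0 := lat_inj h z (by
            have : c * ‖φ z‖ ≤ κ * a := by gcongr
            linarith)
          subst this
          apply hz2
          rw [map_zero]
          exact Submodule.zero_mem _
      · refine le_trans (le_of_eq ?_) (zero_le)
        rw [ENNReal.tsum_eq_zero]
        intro z
        exact if_neg fun hz => hm (hadm z hz).1
    refine (ENNReal.tsum_le_tsum key).trans ?_
    rw [ENNReal.tsum_mul_right]
    refine (mul_le_mul_left H1' _).trans (le_of_eq ?_)
    rw [← ENNReal.ofReal_mul (mul_nonneg hC1.le (Finset.prod_nonneg fun j _ => mul_nonneg (hδ _) (pow_nonneg (hA _).le _)))]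
    congr 1
    rw [Fin.prod_univ_castSucc, ← ha, ← hD, mul_pow]
    ring


theorem euc_norm_le_sum {d : ℕ} (x : EuclideanSpace ℝ (Fin d)) : ‖x‖ ≤ ∑ i, |x i| := by
  have h : x = ∑ i, EuclideanSpace.single i (x i) := by
    ext j
    simp [Finset.sum_apply, Pi.single_apply]
  conv_lhs => rw [h]
  refine (norm_sum_le _ _).trans (le_of_eq ?_)
  simp

/-- y region -/
def Yset {e s : ℕ} (x : Fin s → EuclideanSpace ℝ (Fin (e + 1))) (δ : Fin s → ℝ) : Set (Fin e → ℝ) :=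
  {y | (∀ i, |y i| ≤ 1) ∧ ∀ j, |x j 0 - ∑ i, y i * x j i.succ| ≤ δ j}

theorem Yset_meas {e s : ℕ} (x : Fin s → EuclideanSpace ℝ (Fin (e + 1))) (δ : Fin s → ℝ) :
    MeasurableSet (Yset x δ) := by
  have : Yset x δ = (⋂ i, {y | |y i| ≤ 1}) ∩ ⋂ j, {y | |x j 0 - ∑ i, y i * x j i.succ| ≤ δ j} := by
    ext Y; simp [Yset]
  rw [this]
  refine (MeasurableSet.iInter fun j => IsClosed.measurableSet (isClosed_le (by fun_prop) (by fun_prop))).inter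
    (MeasurableSet.iInter fun j => IsClosed.measurableSet (isClosed_le (by fun_prop) (by fun_prop)))

open scoped Pointwise in
theorem cone_vol {e s : ℕ} (x : Fin s → EuclideanSpace ℝ (Fin (e + 1))) (δ : Fin s → ℝ) :
    volume (Yset x δ) ≤ volume (Sset x (fun j => 2 * δ j) (2 * (e + 1))) := by
  set Ψ : ℝ × (Fin e → ℝ) → EuclideanSpace ℝ (Fin (e + 1)) := fun q =>
    WithLp.toLp 2 ((MeasurableEquiv.piFinSuccAbove (fun _ : Fin (e + 1) => ℝ) 0).symm q) with hΨ
  have hmp : MeasurePreserving Ψ :=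
    (PiLp.volume_preserving_toLp (Fin (e + 1))).comp
      (volume_preserving_piFinSuccAbove (fun _ : Fin (e + 1) => ℝ) 0).symm
  have h0 : ∀ q, Ψ q 0 = q.1 := by
    intro q
    simp [hΨ, MeasurableEquiv.piFinSuccAbove]
  have h1 : ∀ q i, Ψ q (Fin.succ i) = q.2 i := by
    intro q i
    simp [hΨ, MeasurableEquiv.piFinSuccAbove]
  rw [← hmp.measure_preimage (Sset_meas _ _ _).nullMeasurableSet, Measure.volume_eq_prod,
    Measure.prod_apply (hmp.measurable (Sset_meas _ _ _))]
  calc volume (Yset x δ) = ∫⁻ _ in Set.Icc (1:ℝ) 2, volume (Yset x δ) := by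
        simp [Real.volume_Icc]; norm_num
    _ ≤ ∫⁻ l in Set.Icc (1:ℝ) 2, volume (Prod.mk l ⁻¹' (Ψ ⁻¹' Sset x (fun j => 2 * δ j) (2 * (e + 1)))) := by
        refine setLIntegral_mono' measurableSet_Icc fun l hl => ?_
        have hsub : (-l) • Yset x δ ⊆ Prod.mk l ⁻¹' (Ψ ⁻¹' Sset x (fun j => 2 * δ j) (2 * (e + 1))) := by
          rintro _ ⟨y, hy, rfl⟩
          refine ⟨?_, fun j => ?_⟩
          · refine (euc_norm_le_sum _).trans ?_
            rw [Fin.sum_univ_succ, h0]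
            simp only [h1]
            have h2 : ∀ i ∈ Finset.univ, |((-l) • y) i| ≤ 2 := by
              intro i _
              simp only [Pi.smul_apply, smul_eq_mul, abs_mul, abs_neg]
              have := hy.1 i
              rw [abs_of_nonneg (by linarith [hl.1] : (0:ℝ) ≤ l)]
              nlinarith [hl.1, hl.2, abs_nonneg (y i)]
            have h3 := Finset.sum_le_card_nsmul _ _ _ h2
            simp only [Finset.card_univ, Fintype.card_fin, nsmul_eq_mul] at h3
            have h4 : |l| ≤ 2 := by rw [abs_of_nonneg (by linarith [hl.1] : (0:ℝ) ≤ l)]; exact hl.2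
            refine (add_le_add h4 h3).trans (by linarith)
          · have e1 : inner ℝ (x j) (Ψ (l, (-l) • y)) = l * (x j 0 - ∑ i, y i * x j i.succ) := by
              rw [PiLp.inner_apply, Fin.sum_univ_succ, h0]
              simp only [h1]
              simp only [RCLike.inner_apply, conj_trivial, Pi.smul_apply, smul_eq_mul]
              rw [mul_sub, Finset.mul_sum, sub_eq_add_neg, ← Finset.sum_neg_distrib]
              congr 1
              refine Finset.sum_congr rfl fun i _ => ?_
              ring
            show |inner ℝ (x j) (Ψ (l, (-l) • y))| ≤ 2 * δ j
            rw [e1, abs_mul, abs_of_nonneg (by linarith [hl.1] : (0:ℝ) ≤ l)]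
            have := hy.2 j
            have h5 := abs_nonneg (x j 0 - ∑ i, y i * x j i.succ)
            nlinarith [hl.1, hl.2]
        refine le_trans ?_ (measure_mono hsub)
        rw [Measure.addHaar_smul]
        refine le_mul_of_one_le_left (zero_le) ?_
        rw [abs_pow, abs_neg, ← ENNReal.ofReal_one]
        refine ENNReal.ofReal_le_ofReal (one_le_pow₀ ?_)
        rw [abs_of_nonneg (by linarith [hl.1] : (0:ℝ) ≤ l)]
        exact hl.1
    _ ≤ _ := setLIntegral_le_lintegral _ _

/-- union over tuples -/
def Uset {e s : ℕ} (φ : (Fin (e + 1) → ℤ) →+ EuclideanSpace ℝ (Fin (e + 1))) (δ A : Fin s → ℝ) : Set (Fin e → ℝ) :=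
  ⋃ m : Fin s → Fin (e + 1) → ℤ, {y | Adm φ A m ∧ y ∈ Yset (fun j => φ (m j)) δ}

theorem Uset_meas {e s : ℕ} (φ : (Fin (e + 1) → ℤ) →+ EuclideanSpace ℝ (Fin (e + 1))) (δ A : Fin s → ℝ) :
    MeasurableSet (Uset φ δ A) :=
  MeasurableSet.iUnion fun m => (MeasurableSet.const _).inter (Yset_meas _ _)

theorem Uset_vol {e : ℕ} (he : 1 ≤ e) {c : ℝ} {φ : (Fin (e + 1) → ℤ) →+ EuclideanSpace ℝ (Fin (e + 1))}
    (h : LatD (e + 1) c φ) (κ : ℝ) (hκ : c ≤ κ) (s : ℕ) (hs : s ≤ e) : ∃ C : ℝ, 0 < C ∧ ∀ δ A : Fin s → ℝ,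
      (∀ j, 0 ≤ δ j) → (∀ j, 0 < A j) → (∀ i j, i ≤ j → A i ≤ κ * A j) →
      volume (Uset φ δ A) ≤ ENNReal.ofReal (C * ∏ j, (δ j * A j ^ e)) := by
  obtain ⟨C, hC, H⟩ := tuple_sum (by omega) h κ hκ s (by omega) (2 * (e + 1))
  refine ⟨C * 2 ^ s, by positivity, fun δ A hδ hA hmon => ?_⟩
  have h1 := H (fun j => 2 * δ j) A (fun j => by have := hδ j; positivity) hA hmon
  refine (measure_iUnion_le _).trans ((ENNReal.tsum_le_tsum fun m => ?_).trans (h1.trans (le_of_eq ?_)))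
  · split_ifs with hm
    · refine (measure_mono ?_).trans (cone_vol _ _)
      exact fun y hy => hy.2
    · refine le_of_eq ?_
      convert measure_empty (μ := (volume : Measure (Fin e → ℝ)))
      ext y; simp [hm]
  · congr 1
    rw [mul_assoc]
    congr 1
    simp only [mul_assoc, Nat.add_sub_cancel]
    rw [Finset.prod_mul_distrib (f := fun _ => (2:ℝ))]
    simp

/-- the lattice map -/
def phiM {d : ℕ} (M : Matrix (Fin d) (Fin d) ℝ) : (Fin d → ℤ) →+ EuclideanSpace ℝ (Fin d) where
  toFun m := WithLp.toLp 2 (M⁻¹ *ᵥ (fun i => (m i : ℝ)))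
  map_zero' := by
    have : (fun i : Fin d => (((0 : Fin d → ℤ) i : ℤ) : ℝ)) = 0 := by funext i; simp
    rw [this, Matrix.mulVec_zero]; rfl
  map_add' a b := by
    have : (fun i : Fin d => (((a + b) i : ℤ) : ℝ)) = (fun i => (a i : ℝ)) + (fun i => (b i : ℝ)) := by
      funext i; simp
    rw [this, Matrix.mulVec_add]; rfl

theorem mulVec_abs_le {d : ℕ} (M : Matrix (Fin d) (Fin d) ℝ) (x : Fin d → ℝ) (b : ℝ) (hb : ∀ i, |x i| ≤ b) (i : Fin d) :
    |(M *ᵥ x) i| ≤ (∑ i, ∑ j, |M i j|) * b := by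
  have hb0 : 0 ≤ b := (abs_nonneg _).trans (hb i)
  have h1 : |(M *ᵥ x) i| ≤ (∑ j, |M i j|) * b := by
    rw [Matrix.mulVec, dotProduct, Finset.sum_mul]
    refine (Finset.abs_sum_le_sum_abs _ _).trans (Finset.sum_le_sum fun j _ => ?_)
    rw [abs_mul]
    exact mul_le_mul_of_nonneg_left (hb j) (abs_nonneg _)
  refine h1.trans (mul_le_mul_of_nonneg_right ?_ hb0)
  exact Finset.single_le_sum (f := fun i => ∑ j, |M i j|) (fun i _ => Finset.sum_nonneg fun j _ => abs_nonneg _) (Finset.mem_univ i)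

theorem phiM_lat {d : ℕ} (M : Matrix (Fin d) (Fin d) ℝ) (hM : M.det = 1) : ∃ c, LatD d c (phiM M) := by
  have hu : IsUnit M.det := by rw [hM]; exact isUnit_one
  set S1 := ∑ i, ∑ j, |M i j| with hS1
  set S2 := ∑ i, ∑ j, |M⁻¹ i j| with hS2
  have hS1' : 0 ≤ S1 := Finset.sum_nonneg fun _ _ => Finset.sum_nonneg fun _ _ => abs_nonneg _
  have hS2' : 0 ≤ S2 := Finset.sum_nonneg fun _ _ => Finset.sum_nonneg fun _ _ => abs_nonneg _
  have hd0 : (0 : ℝ) ≤ d := Nat.cast_nonneg d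
  refine ⟨1 + S1 + d * S2, by nlinarith, ?_, ?_⟩
  · intro m i
    have h1 : M *ᵥ (M⁻¹ *ᵥ (fun i => (m i : ℝ))) = fun i => (m i : ℝ) := by
      rw [Matrix.mulVec_mulVec, Matrix.mul_nonsing_inv _ hu, Matrix.one_mulVec]
    have h2 := mulVec_abs_le M (M⁻¹ *ᵥ (fun i => (m i : ℝ))) ‖phiM M m‖ (fun i => PiLp.norm_apply_le (phiM M m) i) i
    rw [h1] at h2
    refine h2.trans ?_
    rw [← hS1]
    have : 0 ≤ ‖phiM M m‖ := norm_nonneg _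
    have : 0 ≤ d * S2 := by positivity
    gcongr
    linarith
  · intro z
    refine ⟨fun i => round ((M *ᵥ z.ofLp) i), ?_⟩
    refine (euc_norm_le_sum _).trans ?_
    have h1 : ∀ i ∈ Finset.univ, |(z - phiM M (fun i => round ((M *ᵥ z.ofLp) i))) i| ≤ S2 := by
      intro i _
      have e1 : (z - phiM M (fun i => round ((M *ᵥ z.ofLp) i))) i =
          (M⁻¹ *ᵥ (fun i => (M *ᵥ z.ofLp) i - (round ((M *ᵥ z.ofLp) i) : ℝ))) i := by
        have : (fun i => (M *ᵥ z.ofLp) i - (round ((M *ᵥ z.ofLp) i) : ℝ)) =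
          (M *ᵥ z.ofLp) - (fun i => (round ((M *ᵥ z.ofLp) i) : ℝ)) := rfl
        rw [this, Matrix.mulVec_sub, Matrix.mulVec_mulVec, Matrix.nonsing_inv_mul _ hu, Matrix.one_mulVec]
        rfl
      rw [e1]
      refine (mulVec_abs_le _ _ (1 / 2) (fun i => abs_sub_round _) i).trans ?_
      rw [← hS2]
      linarith
    refine (Finset.sum_le_card_nsmul _ _ _ h1).trans ?_
    simp only [Finset.card_univ, Fintype.card_fin, nsmul_eq_mul]
    linarith


theorem q_ge_one : (1:ℝ) ≤ 2 / Real.sqrt 3 := by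
  rw [le_div_iff₀ (by positivity), one_mul]
  rw [show (2:ℝ) = Real.sqrt 4 by rw [show (4:ℝ) = 2 ^ 2 by norm_num]; simp]
  exact Real.sqrt_le_sqrt (by norm_num)

theorem siegel_mono {d : ℕ} {v : Fin d → ℝ} (hv : SiegelV d v) (i j : Fin d) (hij : i ≤ j) :
    v j ≤ (2 / Real.sqrt 3) ^ d * v i := by
  have key : ∀ n : ℕ, ∀ j : Fin d, (j : ℕ) = i + n → v j ≤ (2 / Real.sqrt 3) ^ n * v i := by
    intro n
    induction n with
    | zero =>
      intro j hj
      have : j = i := Fin.ext (by omega)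
      subst this; simp
    | succ n ih =>
      intro j hj
      have h1 := ih ⟨i + n, by omega⟩ rfl
      have h2 := hv.2.2 ⟨i + n, by omega⟩ j (by simp; omega)
      rw [pow_succ']
      have := q_ge_one
      refine h2.trans ?_
      rw [mul_assoc]
      gcongr
  have hle : (i : ℕ) ≤ j := hij
  refine (key (j - i) j (by omega)).trans ?_
  have := (hv.1 i).le
  gcongr
  · exact q_ge_one
  · have := j.isLt; omega

theorem nMat_tri (d : ℕ) (u : Fin d → Fin d → ℝ) : (nMat d u).BlockTriangular id := by
  intro i j hij
  simp only [id] at hij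
  simp [nMat, hij.ne', hij.not_gt, Matrix.of_apply]

theorem nMat_det (d : ℕ) (u : Fin d → Fin d → ℝ) : (nMat d u).det = 1 := by
  rw [Matrix.det_of_isUpperTriangular (nMat_tri d u)]
  simp [nMat]

theorem nMat_inv_tri (d : ℕ) (u : Fin d → Fin d → ℝ) (i j : Fin d) (h : j < i) : (nMat d u)⁻¹ i j = 0 := by
  have : Invertible (nMat d u) := Matrix.invertibleOfIsUnitDet _ (by rw [nMat_det]; exact isUnit_one)
  exact Matrix.blockTriangular_inv_of_blockTriangular (nMat_tri d u) h

theorem nMat_inv_le (d : ℕ) (u : Fin d → Fin d → ℝ) (hu : ∀ i j : Fin d, i < j → |u i j| ≤ 1 / 2) (i j : Fin d) :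
    |(nMat d u)⁻¹ i j| ≤ (d.factorial : ℝ) := by
  rw [Matrix.inv_def, nMat_det]
  simp only [Ring.inverse_one, one_smul, Matrix.adjugate_apply]
  have := Matrix.det_le (A := (nMat d u).updateRow j (Pi.single i 1)) (abv := AbsoluteValue.abs) (x := (1:ℝ)) ?_
  · simpa using this
  · intro a b
    simp only [AbsoluteValue.abs_apply, Matrix.updateRow_apply]
    split_ifs with h
    · by_cases hb : b = i
      · subst hb; simp
      · simp [hb]
    · simp only [nMat, Matrix.of_apply]
      split_ifs with h1 h2
      · simp
      · have := hu _ _ h2; linarith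
      · simp

theorem orth_le {d : ℕ} (k : Matrix (Fin d) (Fin d) ℝ) (hk : k * kᵀ = 1) (i j : Fin d) : |k i j| ≤ 1 := by
  have h1 : ∑ l, k i l * k i l = 1 := by
    have := congrFun (congrFun hk i) i
    simpa [Matrix.mul_apply] using this
  have h2 : k i j * k i j ≤ 1 := by
    rw [← h1]
    exact Finset.single_le_sum (f := fun l => k i l * k i l) (fun l _ => mul_self_nonneg _) (Finset.mem_univ j)
  rw [abs_le]
  constructor <;> nlinarith

/-- constant -/
def Kd (d : ℕ) : ℝ := d * ((2 / Real.sqrt 3) ^ d * d.factorial)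

theorem siegel_inv {d : ℕ} {v : Fin d → ℝ} (hv : SiegelV d v) (u : Fin d → Fin d → ℝ)
    (hu : ∀ i j : Fin d, i < j → |u i j| ≤ 1 / 2) (k : Matrix (Fin d) (Fin d) ℝ) (hk : k * kᵀ = 1) (i j : Fin d) :
    |(nMat d u * Matrix.diagonal v * k)⁻¹ i j| ≤ Kd d / v j := by
  have hD : (Matrix.diagonal v)⁻¹ = Matrix.diagonal (fun i => (v i)⁻¹) := by
    refine Matrix.inv_eq_right_inv ?_
    rw [Matrix.diagonal_mul_diagonal, ← Matrix.diagonal_one]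
    congr 1; funext l
    exact mul_inv_cancel₀ (hv.1 l).ne'
  rw [Matrix.mul_inv_rev, Matrix.mul_inv_rev, hD, Matrix.inv_eq_right_inv hk, Matrix.mul_apply]
  have : ∀ l ∈ Finset.univ, |kᵀ i l * (Matrix.diagonal (fun i => (v i)⁻¹) * (nMat d u)⁻¹) l j| ≤
      (2 / Real.sqrt 3) ^ d * d.factorial / v j := by
    intro l _
    have hvj := hv.1 j
    have hvl := hv.1 l
    have hq := q_ge_one
    rw [Matrix.diagonal_mul, abs_mul, Matrix.transpose_apply]
    by_cases hlj : j < l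
    · rw [nMat_inv_tri d u l j hlj]
      simp; positivity
    · have h1 := orth_le k hk l i
      have h2 := nMat_inv_le d u hu l j
      have h3 := siegel_mono hv l j (not_lt.1 hlj)
      have h4 : |(v l)⁻¹ * (nMat d u)⁻¹ l j| ≤ (2 / Real.sqrt 3) ^ d * d.factorial / v j := by
        rw [abs_mul, abs_of_pos (inv_pos.2 hvl)]
        have h5 : (v l)⁻¹ ≤ (2 / Real.sqrt 3) ^ d / v j := by
          rw [inv_eq_one_div, div_le_div_iff₀ hvl hvj]; linarith
        calc _ ≤ (2 / Real.sqrt 3) ^ d / v j * d.factorial := by gcongr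
          _ = _ := by ring
      calc _ ≤ 1 * _ := mul_le_mul h1 h4 (abs_nonneg _) zero_le_one
        _ = _ := one_mul _
  refine (Finset.abs_sum_le_sum_abs _ _).trans ((Finset.sum_le_card_nsmul _ _ _ this).trans (le_of_eq ?_))
  simp [Kd]; ring

theorem ntilde_det (d : ℕ) (y : Fin (d - 1) → ℝ) : (ntilde d y).det = 1 := by
  rw [Matrix.det_of_isUpperTriangular]
  · simp [ntilde]
  · intro i j hij
    simp only [id] at hij
    have h1 : ¬ ((i : ℕ) = 0 ∧ 1 ≤ (j:ℕ)) := by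
      rintro ⟨h, _⟩
      have : (j : ℕ) < i := hij
      omega
    simp [ntilde, hij.ne', h1]

theorem Phi_det (e : ℕ) (t : ℝ) : (Phi (e + 1) t).det = 1 := by
  rw [Phi, Matrix.det_diagonal, Fin.prod_univ_succ]
  simp only [Fin.val_zero, if_true, Fin.val_succ, Nat.add_eq_zero_iff, one_ne_zero, and_false, if_false]
  rw [Finset.prod_const, Finset.card_univ, Fintype.card_fin, ← Real.exp_nat_mul, ← Real.exp_add, Real.exp_eq_one_iff]
  push_cast
  field_simp
  ring

theorem nPhi_mulVec (e : ℕ) (t : ℝ) (y : Fin e → ℝ) (z : Fin (e + 1) → ℝ) :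
    ((ntilde (e + 1) y * Phi (e + 1) t) *ᵥ z) 0 =
      Real.exp (-(e : ℝ) * t / (e + 1 : ℕ)) * z 0 + ∑ i, y i * (Real.exp (t / (e + 1 : ℕ)) * z i.succ) ∧
    ∀ i : Fin e, ((ntilde (e + 1) y * Phi (e + 1) t) *ᵥ z) i.succ = Real.exp (t / (e + 1 : ℕ)) * z i.succ := by
  have h1 : Phi (e + 1) t *ᵥ z = fun i : Fin (e + 1) => (if (i : ℕ) = 0 then Real.exp (-(e : ℝ) * t / (e + 1 : ℕ)) else Real.exp (t / (e + 1 : ℕ))) * z i := by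
    funext i
    rw [Phi, Matrix.mulVec_diagonal]
    congr 3
    all_goals (push_cast; ring_nf)
  rw [← Matrix.mulVec_mulVec, h1]
  constructor
  · rw [Matrix.mulVec, dotProduct, Fin.sum_univ_succ]
    congr 1
    simp [ntilde]
  · intro i
    rw [Matrix.mulVec, dotProduct, Finset.sum_eq_single i.succ]
    · simp [ntilde]
    · intro b _ hb
      simp [ntilde, hb.symm]
    · simp

/-- the scale factors -/
def aE (e : ℕ) (t : ℝ) : ℝ := Real.exp (-(e : ℝ) * t / (e + 1 : ℕ))
def bE (e : ℕ) (t : ℝ) : ℝ := Real.exp (t / (e + 1 : ℕ))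

theorem aE_pos (e : ℕ) (t : ℝ) : 0 < aE e t := Real.exp_pos _
theorem bE_pos (e : ℕ) (t : ℝ) : 0 < bE e t := Real.exp_pos _
theorem aE_le (e : ℕ) (t : ℝ) (ht : 0 < t) : aE e t ≤ bE e t := by
  unfold aE bE
  refine Real.exp_le_exp.2 ?_
  have : (0:ℝ) < (e + 1 : ℕ) := by positivity
  rw [div_le_div_iff_of_pos_right this]
  have : (0:ℝ) ≤ e := by positivity
  nlinarith
theorem ab_eq (e : ℕ) (t : ℝ) : aE e t * bE e t ^ e = 1 := by
  unfold aE bE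
  rw [← Real.exp_nat_mul, ← Real.exp_add, Real.exp_eq_one_iff]
  ring

theorem reduction {e : ℕ} (ξ : Fin (e + 1) → ℝ) (M0 : Matrix (Fin (e + 1)) (Fin (e + 1)) ℝ) (hM0 : M0.det = 1)
    (vc bc : (Matrix (Fin (e + 1)) (Fin (e + 1)) ℝ × (Fin (e + 1) → ℝ)) → (Fin (e + 1) → ℝ))
    (hsec : IsSiegelSection (e + 1) vc bc) (t : ℝ) (ht : 0 < t) (y : Fin e → ℝ) (hy : ∀ i, |y i| ≤ 1) :
    SiegelV (e + 1) (vc (gElt (e + 1) ξ M0 y t)) ∧ ∃ m : Fin (e + 1) → Fin (e + 1) → ℤ,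
      LinearIndependent ℝ (fun j => phiM M0 (m j)) ∧
      (∀ j, ‖phiM M0 (m j)‖ ≤ (2 * e + 1) * bE e t * (Kd (e + 1) / vc (gElt (e + 1) ξ M0 y t) j)) ∧
      ∀ j, |phiM M0 (m j) 0 - ∑ i, y i * phiM M0 (m j) i.succ| ≤
        aE e t * (Kd (e + 1) / vc (gElt (e + 1) ξ M0 y t) j) := by
  set g := gElt (e + 1) ξ M0 y t with hg
  have hg1 : g.1 = M0 * (ntilde (e + 1) y * Phi (e + 1) t) := by rw [← Matrix.mul_assoc]; rfl
  have hP1 : (ntilde (e + 1) y * Phi (e + 1) t).det = 1 := by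
    rw [Matrix.det_mul, Phi_det, ntilde_det (e + 1) y]; simp
  have hgdet : g.1.det = 1 := by rw [hg1, Matrix.det_mul, hP1, hM0]; simp
  obtain ⟨hv, -, u, k, hu, hk, hkd, γ, n, hγ, hrel, -⟩ := hsec.2.2 g hgdet
  simp only at hrel
  refine ⟨hv, fun j i => γ.adjugate i j, ?_⟩
  set v := vc g
  set Z := (nMat (e + 1) u * Matrix.diagonal v * k)⁻¹ with hZ
  have hZb := siegel_inv hv u hu k hk
  rw [← hZ] at hZb
  set P := ntilde (e + 1) y * Phi (e + 1) t with hP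
  set γR : Matrix (Fin (e + 1)) (Fin (e + 1)) ℝ := γ.map fun x => (x : ℝ) with hγR
  have hγRd : γR.det = 1 := by
    have := (Int.castRingHom ℝ).map_det γ
    rw [hγ] at this
    simpa [hγR, RingHom.mapMatrix_apply] using this.symm
  have hadj : γR⁻¹ = γ.adjugate.map fun x => (x : ℝ) := by
    rw [Matrix.inv_def, hγRd]
    have := (Int.castRingHom ℝ).map_adjugate γ
    simp only [Ring.inverse_one, one_smul]
    simpa [hγR, RingHom.mapMatrix_apply] using this.symm
  have hZ2 : Z = P⁻¹ * (M0⁻¹ * γR⁻¹) := by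
    rw [hZ, hrel, hg1, Matrix.mul_inv_rev, Matrix.mul_inv_rev, Matrix.mul_assoc]
  have hX : M0⁻¹ * γR⁻¹ = P * Z := by
    rw [hZ2, ← Matrix.mul_assoc, Matrix.mul_nonsing_inv _ (by rw [hP1]; exact isUnit_one), Matrix.one_mul]
  have hphi : ∀ j i, phiM M0 (fun i => γ.adjugate i j) i = (P *ᵥ (fun l => Z l j)) i := by
    intro j i
    have : (M0⁻¹ * γR⁻¹) i j = (P * Z) i j := by rw [hX]
    rw [hadj, Matrix.mul_apply, Matrix.mul_apply] at this
    exact this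
  have h0 : ∀ j, phiM M0 (fun i => γ.adjugate i j) 0 = aE e t * Z 0 j + ∑ i, y i * (bE e t * Z (Fin.succ i) j) := by
    intro j; rw [hphi, (nPhi_mulVec e t y _).1]; rfl
  have h1 : ∀ j i, phiM M0 (fun i => γ.adjugate i j) (Fin.succ i) = bE e t * Z (Fin.succ i) j := by
    intro j i; rw [hphi, (nPhi_mulVec e t y _).2]; rfl
  have ha := aE_pos e t
  have hb := bE_pos e t
  have hab := aE_le e t ht
  refine ⟨?_, fun j => ?_, fun j => ?_⟩
  · have hdet : IsUnit (M0⁻¹ * γR⁻¹) := by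
      rw [Matrix.isUnit_iff_isUnit_det, Matrix.det_mul, Matrix.det_nonsing_inv, Matrix.det_nonsing_inv, hM0, hγRd]
      simp
    have hli := Matrix.linearIndependent_cols_of_isUnit hdet
    have := hli.map' (WithLp.linearEquiv 2 ℝ (Fin (e + 1) → ℝ)).symm.toLinearMap (LinearEquiv.ker _)
    have hfun : (fun j => phiM M0 (fun i => γ.adjugate i j)) =
        (WithLp.linearEquiv 2 ℝ (Fin (e + 1) → ℝ)).symm.toLinearMap ∘ (M0⁻¹ * γR⁻¹).col := by
      funext j
      ext i
      rw [hphi, hX, Matrix.mulVec]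
      rfl
    rw [hfun]
    exact this
  · refine (euc_norm_le_sum _).trans ?_
    rw [Fin.sum_univ_succ, h0]
    simp only [h1]
    set B := Kd (e + 1) / v j with hB
    have hB0 : 0 ≤ B := (abs_nonneg _).trans (hZb 0 j)
    have t1 : ∀ i : Fin e, i ∈ Finset.univ → |bE e t * Z (Fin.succ i) j| ≤ bE e t * B := by
      intro i _
      rw [abs_mul, abs_of_pos hb]
      exact mul_le_mul_of_nonneg_left (hZb _ _) hb.le
    have t2 : ∀ i : Fin e, i ∈ Finset.univ → |y i * (bE e t * Z (Fin.succ i) j)| ≤ bE e t * B := by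
      intro i hi
      rw [abs_mul]
      calc _ ≤ 1 * (bE e t * B) := mul_le_mul (hy i) (t1 i hi) (abs_nonneg _) zero_le_one
        _ = _ := one_mul _
    have s1 := Finset.sum_le_card_nsmul _ _ _ t1
    have s2 := (Finset.abs_sum_le_sum_abs _ _).trans (Finset.sum_le_card_nsmul _ _ _ t2)
    simp only [Finset.card_univ, Fintype.card_fin, nsmul_eq_mul] at s1 s2
    have t3 : |aE e t * Z 0 j| ≤ bE e t * B := by
      rw [abs_mul, abs_of_pos ha]
      exact mul_le_mul hab (hZb _ _) (abs_nonneg _) hb.le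
    have t4 := abs_add_le (aE e t * Z 0 j) (∑ i, y i * (bE e t * Z (Fin.succ i) j))
    calc _ ≤ (bE e t * B + e * (bE e t * B)) + e * (bE e t * B) := by
          gcongr; exact t4.trans (add_le_add t3 s2)
      _ = _ := by ring
  · rw [h0]
    simp only [h1]
    rw [add_sub_cancel_right, abs_mul, abs_of_pos ha]
    exact mul_le_mul_of_nonneg_left (hZb _ _) ha.le


theorem prod_filter_castLE {d s : ℕ} (h : s ≤ d) (f : Fin d → ℝ) :
    ∏ i ∈ Finset.univ.filter (fun i : Fin d => (i : ℕ) < s), f i = ∏ j : Fin s, f (Fin.castLE h j) := by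
  symm
  refine Finset.prod_bij (fun j _ => Fin.castLE h j) ?_ ?_ ?_ ?_
  · intro a _; simp
  · intro a _ b _ hab; simpa using hab
  · intro b hb
    simp only [Finset.mem_filter, Finset.mem_univ, true_and] at hb
    exact ⟨⟨b, hb⟩, Finset.mem_univ _, rfl⟩
  · intros; rfl

theorem sVal_le (e : ℕ) (r : ℝ) (v : Fin (e + 1) → ℝ) : sVal (e + 1) r v ≤ e := by
  refine csSup_le' ?_
  rintro s ⟨_, h, _⟩
  exact h

theorem sVal_spec (e : ℕ) (r : ℝ) (hr : 0 < r) (v : Fin (e + 1) → ℝ) (hv : SiegelV (e + 1) v) (j : Fin (e + 1))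
    (hj : (j : ℕ) < sVal (e + 1) r v) : 2 * cd' (e + 1) * r / (2 / Real.sqrt 3) ^ (e + 1) ≤ v j := by
  have hne : {s : ℕ | 1 ≤ s ∧ s ≤ (e + 1) - 1 ∧ ∃ i : Fin (e + 1), (i : ℕ) + 1 = s ∧ 2 * cd' (e + 1) * r < v i}.Nonempty := by
    by_contra hne
    rw [Set.not_nonempty_iff_eq_empty] at hne
    rw [sVal, hne] at hj
    simp at hj
  have hmem := Nat.sSup_mem hne ⟨e, fun s hs => hs.2.1⟩
  obtain ⟨_, _, i, hi, hvi⟩ := hmem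
  change (i : ℕ) + 1 = sVal (e + 1) r v at hi
  have hq := q_ge_one
  rw [div_le_iff₀ (by positivity)]
  have := siegel_mono hv j i (by rw [Fin.le_def]; omega)
  linarith

theorem F_bound (e : ℕ) (R η r ε' : ℝ) (hR : 2 ≤ R) (v b : Fin (e + 1) → ℝ)
    (hv : SiegelV (e + 1) v) (hε : ε' ≤ ((e + 1 : ℕ) : ℝ) - η) (s : ℕ) (hs : s = sVal (e + 1) r v) (hse : s ≤ e + 1) :
    0 ≤ Ffun (e + 1) R η r v b ∧ Ffun (e + 1) R η r v b ≤ R ^ (-(((e + 1 : ℕ) : ℝ) - η) + ε') *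
      ∏ j : Fin s, v (Fin.castLE hse j) ^ (((e + 1 : ℕ) : ℝ) - ε') := by
  unfold Ffun
  rw [← hs, prod_filter_castLE hse, prod_filter_castLE hse]
  set w : Fin s → ℝ := fun j => v (Fin.castLE hse j) with hw
  have hw0 : ∀ j, 0 < w j := fun j => hv.1 _
  have hp : 0 < ∏ j, w j := Finset.prod_pos fun j _ => hw0 j
  have hfac : ∀ j : Fin s, 0 ≤ w j ^ η * (if |v (Fin.castLE hse j) * b (Fin.castLE hse j)| ≤ cd' (e + 1) * r then (1:ℝ) else 0) ∧
      w j ^ η * (if |v (Fin.castLE hse j) * b (Fin.castLE hse j)| ≤ cd' (e + 1) * r then (1:ℝ) else 0) ≤ w j ^ η := by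
    intro j
    have := Real.rpow_pos_of_pos (hw0 j) η
    split_ifs <;> simp [this.le]
  constructor
  · refine mul_nonneg (by split_ifs <;> norm_num) (Finset.prod_nonneg fun j _ => (hfac j).1)
  · split_ifs with h
    · rw [one_mul]
      refine (Finset.prod_le_prod (fun j _ => (hfac j).1) (fun j _ => (hfac j).2)).trans ?_
      rw [Real.finsetProd_rpow _ _ (fun j _ => (hw0 j).le), Real.finsetProd_rpow _ _ (fun j _ => (hv.1 _).le)]
      change (∏ j, w j) ^ η ≤ _ * (∏ j, w j) ^ _
      calc (∏ j, w j) ^ η = (∏ j, w j) ^ (-(((e + 1 : ℕ) : ℝ) - η) + ε') * (∏ j, w j) ^ (((e + 1 : ℕ) : ℝ) - ε') := by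
            rw [← Real.rpow_add hp]; congr 1; ring
        _ ≤ _ := by
            gcongr ?_ * _
            exact Real.rpow_le_rpow_of_nonpos (by linarith) h (by linarith)
    · rw [zero_mul]
      refine mul_nonneg (Real.rpow_nonneg (by linarith) _) (Finset.prod_nonneg fun j _ => Real.rpow_nonneg (hv.1 _).le _)

theorem tsum_pi_prod (f : ℕ → ENNReal) (s : ℕ) :
    ∑' n : Fin s → ℕ, ∏ j, f (n j) = (∑' k, f k) ^ s := by
  induction s with
  | zero => simp
  | succ s ih =>
    rw [← (Fin.consEquiv (fun _ : Fin (s + 1) => ℕ)).tsum_eq, ENNReal.tsum_prod']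
    simp only [Fin.consEquiv_apply, Fin.prod_univ_succ, Fin.cons_zero, Fin.cons_succ]
    simp only [ENNReal.tsum_mul_left, ENNReal.tsum_mul_right, ih, pow_succ']


/-- near monotone pieces -/
def Wset {e s : ℕ} (φ : (Fin (e + 1) → ℤ) →+ EuclideanSpace ℝ (Fin (e + 1))) (κ c0 a b : ℝ) (n : Fin s → ℕ) :
    Set (Fin e → ℝ) :=
  {y | (∀ i j, i ≤ j → (2:ℝ) ^ n j ≤ κ * 2 ^ n i) ∧
    y ∈ Uset φ (fun j => a * (Kd (e + 1) / (c0 * 2 ^ n j))) (fun j => (2 * e + 1) * b * (Kd (e + 1) / (c0 * 2 ^ n j)))}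

theorem Wset_meas {e s : ℕ} (φ : (Fin (e + 1) → ℤ) →+ EuclideanSpace ℝ (Fin (e + 1))) (κ c0 a b : ℝ) (n : Fin s → ℕ) :
    MeasurableSet (Wset φ κ c0 a b n) :=
  (MeasurableSet.const _).inter (Uset_meas _ _ _)

theorem Kd_pos (e : ℕ) : 0 < Kd (e + 1) := by
  unfold Kd
  have := q_ge_one
  positivity

theorem Wset_vol {e : ℕ} (he : 1 ≤ e) {c : ℝ} {φ : (Fin (e + 1) → ℤ) →+ EuclideanSpace ℝ (Fin (e + 1))}
    (h : LatD (e + 1) c φ) (κ : ℝ) (hκ : c ≤ κ) (c0 : ℝ) (hc0 : 0 < c0) (s : ℕ) (hs : s ≤ e) :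
    ∃ C : ℝ, 0 < C ∧ ∀ (t : ℝ) (n : Fin s → ℕ), volume (Wset φ κ c0 (aE e t) (bE e t) n) ≤
      ENNReal.ofReal (C * ∏ j, ((2 * e + 1) ^ e * (Kd (e + 1) / (c0 * 2 ^ n j)) ^ (e + 1))) := by
  obtain ⟨C, hC, H⟩ := Uset_vol he h κ hκ s hs
  refine ⟨C, hC, fun t n => ?_⟩
  have hK := Kd_pos e
  have ha := aE_pos e t
  have hb := bE_pos e t
  by_cases hn : ∀ i j, i ≤ j → (2:ℝ) ^ n j ≤ κ * 2 ^ n i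
  · refine (measure_mono fun y hy => hy.2).trans ((H _ _ (fun j => by positivity) (fun j => by positivity) ?_).trans (le_of_eq ?_))
    · intro i j hij
      have := hn i j hij
      have h1 : Kd (e + 1) / (c0 * 2 ^ n i) ≤ κ * (Kd (e + 1) / (c0 * 2 ^ n j)) := by
        rw [← mul_div_assoc, div_le_div_iff₀ (by positivity) (by positivity)]
        calc _ = (Kd (e + 1) * c0) * 2 ^ n j := by ring
          _ ≤ (Kd (e + 1) * c0) * (κ * 2 ^ n i) := by gcongr
          _ = _ := by ring
      calc _ ≤ (2 * e + 1) * bE e t * (κ * (Kd (e + 1) / (c0 * 2 ^ n j))) := by gcongr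
        _ = _ := by ring
    · congr 2
      refine Finset.prod_congr rfl fun j _ => ?_
      rw [mul_pow, mul_pow]
      calc _ = (aE e t * bE e t ^ e) * ((2 * e + 1) ^ e * (Kd (e + 1) / (c0 * 2 ^ n j)) ^ (e + 1)) := by ring
        _ = _ := by rw [ab_eq, one_mul]
  · have : Wset φ κ c0 (aE e t) (bE e t) n = ∅ := by
      ext y
      simp only [Wset, Set.mem_setOf_eq, Set.mem_empty_iff_false, iff_false]
      exact fun hy => hn hy.1
    rw [this]; simp

/-- weights -/
def wt (e : ℕ) (c0 ε : ℝ) (k : ℕ) : ℝ := (c0 * 2 ^ (k + 1)) ^ (((e + 1 : ℕ) : ℝ) - ε)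

theorem point_bound {e : ℕ} (ξ : Fin (e + 1) → ℝ) (M0 : Matrix (Fin (e + 1)) (Fin (e + 1)) ℝ) (hM0 : M0.det = 1)
    (vc bc : (Matrix (Fin (e + 1)) (Fin (e + 1)) ℝ × (Fin (e + 1) → ℝ)) → (Fin (e + 1) → ℝ))
    (hsec : IsSiegelSection (e + 1) vc bc) (r η ε' : ℝ) (hr : 0 < r) (hη : 0 < η) (hε : ε' ≤ ((e + 1 : ℕ) : ℝ) - η)
    (κ : ℝ) (hκ : 2 * (2 / Real.sqrt 3) ^ (e + 1) ≤ κ)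
    (c0 : ℝ) (hc0 : c0 = 2 * cd' (e + 1) * r / (2 / Real.sqrt 3) ^ (e + 1)) (hc0' : 0 < c0)
    (R : ℝ) (hR : 2 ≤ R)
    (t : ℝ) (ht : 0 < t) (y : Fin e → ℝ) (hy : ∀ i, |y i| ≤ 1) :
    0 ≤ Ffun (e + 1) R η r (vc (gElt (e + 1) ξ M0 y t)) (bc (gElt (e + 1) ξ M0 y t)) ∧
    ∃ (s : Fin (e + 1)) (n : Fin s → ℕ), y ∈ Wset (phiM M0) κ c0 (aE e t) (bE e t) n ∧
      Ffun (e + 1) R η r (vc (gElt (e + 1) ξ M0 y t)) (bc (gElt (e + 1) ξ M0 y t)) ≤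
        R ^ (-(((e + 1 : ℕ) : ℝ) - η) + ε') * ∏ j, wt e c0 ε' (n j) := by
  obtain ⟨hv, m, hli, hA, hδ⟩ := reduction ξ M0 hM0 vc bc hsec t ht y hy
  set v := vc (gElt (e + 1) ξ M0 y t) with hvdef
  set b := bc (gElt (e + 1) ξ M0 y t)
  have hsle := sVal_le e r v
  set s := sVal (e + 1) r v with hs
  have hse : s ≤ e + 1 := by omega
  obtain ⟨hF0, hF⟩ := F_bound e R η r ε' hR v b hv hε s hs hse
  refine ⟨hF0, ⟨s, by omega⟩, ?_⟩
  have hex : ∀ j : Fin s, ∃ k : ℕ, c0 * 2 ^ k ≤ v (Fin.castLE hse j) ∧ v (Fin.castLE hse j) < c0 * 2 ^ (k + 1) := by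
    intro j
    have h1 := sVal_spec e r hr v hv (Fin.castLE hse j) (by simp [← hs])
    rw [← hc0] at h1
    obtain ⟨k, hk1, hk2⟩ := exists_nat_pow_near (y := (2:ℝ)) ((one_le_div hc0').2 h1) (by norm_num)
    refine ⟨k, ?_, ?_⟩
    · rw [le_div_iff₀ hc0'] at hk1; linarith
    · rw [div_lt_iff₀ hc0'] at hk2; linarith
  choose n hn1 hn2 using hex
  have hK := Kd_pos e
  have ha := aE_pos e t
  have hb := bE_pos e t
  have hrho : ∀ j : Fin s, Kd (e + 1) / v (Fin.castLE hse j) ≤ Kd (e + 1) / (c0 * 2 ^ n j) := by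
    intro j
    exact div_le_div_of_nonneg_left hK.le (by positivity) (hn1 j)
  refine ⟨n, ⟨?_, ?_⟩, ?_⟩
  · intro i j hij
    have h1 := siegel_mono hv (Fin.castLE hse i) (Fin.castLE hse j) hij
    have hq := q_ge_one
    have h2 : c0 * 2 ^ n j ≤ c0 * (κ * 2 ^ n i) := by
      calc c0 * 2 ^ n j ≤ v (Fin.castLE hse j) := hn1 j
        _ ≤ (2 / Real.sqrt 3) ^ (e + 1) * v (Fin.castLE hse i) := h1
        _ ≤ (2 / Real.sqrt 3) ^ (e + 1) * (c0 * 2 ^ (n i + 1)) := by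
            gcongr; exact (hn2 i).le
        _ = (2 * (2 / Real.sqrt 3) ^ (e + 1)) * (c0 * 2 ^ n i) := by ring
        _ ≤ κ * (c0 * 2 ^ n i) := by gcongr
        _ = _ := by ring
    exact le_of_mul_le_mul_left h2 hc0'
  · refine Set.mem_iUnion.2 ⟨fun j => m (Fin.castLE hse j), ⟨?_, ?_⟩, hy, ?_⟩
    · exact hli.comp (Fin.castLE hse) (Fin.castLE_injective hse)
    · intro j
      exact (hA _).trans (mul_le_mul_of_nonneg_left (hrho j) (by positivity))
    · intro j
      exact (hδ _).trans (mul_le_mul_of_nonneg_left (hrho j) ha.le)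
  · refine hF.trans ?_
    have hR0 : 0 ≤ R ^ (-(((e + 1 : ℕ) : ℝ) - η) + ε') := Real.rpow_nonneg (by linarith) _
    refine mul_le_mul_of_nonneg_left (Finset.prod_le_prod (fun j _ => Real.rpow_nonneg (hv.1 _).le _) fun j _ => ?_) hR0
    exact Real.rpow_le_rpow (hv.1 _).le (hn2 j).le (by linarith)

theorem wt_mul (e : ℕ) (c0 ε : ℝ) (hc0 : 0 < c0) (k : ℕ) :
    wt e c0 ε k * ((2 * e + 1) ^ e * (Kd (e + 1) / (c0 * 2 ^ k)) ^ (e + 1)) =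
    ((2 * e + 1) ^ e * (Kd (e + 1) / c0) ^ (e + 1) * (c0 * 2) ^ (((e + 1 : ℕ) : ℝ) - ε)) * ((2:ℝ) ^ (-ε)) ^ k := by
  unfold wt
  have h1 : c0 * 2 ^ (k + 1) = (c0 * 2) * 2 ^ k := by ring
  have h2 : Kd (e + 1) / (c0 * 2 ^ k) = Kd (e + 1) / c0 * (2 ^ k)⁻¹ := by
    rw [div_mul_eq_div_div, div_eq_mul_inv _ ((2:ℝ) ^ k)]
  have h3 : ((2:ℝ) ^ k) ^ (((e + 1 : ℕ) : ℝ) - ε) * ((2 ^ k)⁻¹) ^ (e + 1) = ((2:ℝ) ^ (-ε)) ^ k := by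
    have e1 : (((2:ℝ) ^ k)⁻¹) ^ (e + 1) = ((2:ℝ) ^ k) ^ (-((e + 1 : ℕ) : ℝ)) := by
      rw [Real.rpow_neg (by positivity), Real.rpow_natCast, inv_pow]
    rw [e1, ← Real.rpow_add (by positivity), ← Real.rpow_natCast (2:ℝ) k, ← Real.rpow_natCast ((2:ℝ) ^ (-ε)) k, ← Real.rpow_mul (by norm_num), ← Real.rpow_mul (by norm_num)]
    congr 1; ring
  rw [h1, Real.mul_rpow (by positivity) (by positivity), h2, mul_pow, ← h3]
  ring

theorem main_bound {e : ℕ} (he : 1 ≤ e) (ξ : Fin (e + 1) → ℝ) (M0 : Matrix (Fin (e + 1)) (Fin (e + 1)) ℝ) (hM0 : M0.det = 1)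
    (vc bc : (Matrix (Fin (e + 1)) (Fin (e + 1)) ℝ × (Fin (e + 1) → ℝ)) → (Fin (e + 1) → ℝ))
    (hsec : IsSiegelSection (e + 1) vc bc) (r η ε' : ℝ) (hr : 0 < r) (hη : 0 < η) (hε0 : 0 < ε') (hε : ε' ≤ ((e + 1 : ℕ) : ℝ) - η) :
    ∃ C : ℝ, 0 < C ∧ ∀ R : ℝ, 2 ≤ R → ∀ t : ℝ, 0 < t →
      (∫ y in {y : Fin e → ℝ | ∀ i, |y i| ≤ 1},
        Ffun (e + 1) R η r (vc (gElt (e + 1) ξ M0 y t)) (bc (gElt (e + 1) ξ M0 y t))) ≤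
      C * R ^ (-(((e + 1 : ℕ) : ℝ) - η) + ε') := by
  obtain ⟨c, hc⟩ := phiM_lat M0 hM0
  have hq := q_ge_one
  set c0 : ℝ := 2 * cd' (e + 1) * r / (2 / Real.sqrt 3) ^ (e + 1) with hc0
  have hc0' : 0 < c0 := by rw [hc0]; unfold cd'; positivity
  set κ := max c (2 * (2 / Real.sqrt 3) ^ (e + 1)) with hκ
  have hvol : ∀ s : Fin (e + 1), _ := fun s => Wset_vol he hc κ (le_max_left _ _) c0 hc0' s (by omega)
  choose Cs hCs Hs using hvol
  set D : ℝ := (2 * e + 1) ^ e * (Kd (e + 1) / c0) ^ (e + 1) * (c0 * 2) ^ (((e + 1 : ℕ) : ℝ) - ε') with hD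
  have hK := Kd_pos e
  have hD0 : 0 < D := by positivity
  set f : ℕ → ENNReal := fun k => ENNReal.ofReal (D * ((2:ℝ) ^ (-ε')) ^ k) with hf
  have hfsum : ∑' k, f k ≠ ⊤ := by
    have hsm : Summable (fun k : ℕ => D * ((2:ℝ) ^ (-ε')) ^ k) :=
      (summable_geometric_of_lt_one (by positivity) (Real.rpow_lt_one_of_one_lt_of_neg (by norm_num) (by linarith))).mul_left D
    exact hsm.tsum_ofReal_ne_top
  set B : ENNReal := ∑ s : Fin (e + 1), ENNReal.ofReal (Cs s) * (∑' k, f k) ^ (s : ℕ) with hB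
  have hBtop : B ≠ ⊤ := by
    rw [hB, ENNReal.sum_ne_top]
    intro s _
    exact ENNReal.mul_ne_top ENNReal.ofReal_ne_top (ENNReal.pow_ne_top hfsum)
  refine ⟨B.toReal + 1, by positivity, fun R hR t ht => ?_⟩
  set p := -(((e + 1 : ℕ) : ℝ) - η) + ε' with hp
  have hRp : 0 < R ^ p := Real.rpow_pos_of_pos (by linarith) _
  set Q : Set (Fin e → ℝ) := {y | ∀ i, |y i| ≤ 1} with hQ
  have hQm : MeasurableSet Q := by
    have : Q = ⋂ i, {y | |y i| ≤ 1} := by ext Y; simp [hQ]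
    rw [this]
    exact MeasurableSet.iInter fun j => IsClosed.measurableSet (isClosed_le (by fun_prop) (by fun_prop))
  set F : (Fin e → ℝ) → ℝ := fun y => Ffun (e + 1) R η r (vc (gElt (e + 1) ξ M0 y t)) (bc (gElt (e + 1) ξ M0 y t)) with hF
  have hpt : ∀ y ∈ Q, _ := fun y hy => point_bound ξ M0 hM0 vc bc hsec r η ε' hr hη hε κ (le_max_right _ _) c0 hc0 hc0' R hR t ht y hy
  have hwt : ∀ k, 0 ≤ wt e c0 ε' k := fun k => Real.rpow_nonneg (by positivity) _
  have hlin : ∫⁻ y in Q, ENNReal.ofReal (F y) ≤ ENNReal.ofReal (R ^ p) * B := by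
    calc ∫⁻ y in Q, ENNReal.ofReal (F y) ≤ ∫⁻ y in Q, ∑ s : Fin (e + 1), ∑' n : Fin s → ℕ,
          (Wset (phiM M0) κ c0 (aE e t) (bE e t) n).indicator (fun _ => ENNReal.ofReal (R ^ p * ∏ j, wt e c0 ε' (n j))) y := by
          refine setLIntegral_mono' hQm fun y hy => ?_
          obtain ⟨-, s, n, hW, hle⟩ := hpt y hy
          refine (ENNReal.ofReal_le_ofReal hle).trans ?_
          refine le_trans ?_ (Finset.single_le_sum (f := fun s : Fin (e + 1) => ∑' n : Fin s → ℕ,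
            (Wset (phiM M0) κ c0 (aE e t) (bE e t) n).indicator (fun _ => ENNReal.ofReal (R ^ p * ∏ j, wt e c0 ε' (n j))) y) (fun _ _ => zero_le) (Finset.mem_univ s))
          refine le_trans ?_ (ENNReal.le_tsum n)
          rw [Set.indicator_of_mem hW]
      _ ≤ ∫⁻ y, ∑ s : Fin (e + 1), ∑' n : Fin s → ℕ,
          (Wset (phiM M0) κ c0 (aE e t) (bE e t) n).indicator (fun _ => ENNReal.ofReal (R ^ p * ∏ j, wt e c0 ε' (n j))) y :=
          setLIntegral_le_lintegral _ _
      _ = ∑ s : Fin (e + 1), ∑' n : Fin s → ℕ, ENNReal.ofReal (R ^ p * ∏ j, wt e c0 ε' (n j)) * volume (Wset (phiM M0) κ c0 (aE e t) (bE e t) n) := by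
          rw [lintegral_finsetSum]
          · refine Finset.sum_congr rfl fun s _ => ?_
            rw [lintegral_tsum (fun n => (measurable_const.indicator (Wset_meas _ _ _ _ _ _)).aemeasurable)]
            refine tsum_congr fun n => ?_
            rw [lintegral_indicator_const (Wset_meas _ _ _ _ _ _)]
          · intro s _
            exact Measurable.ennreal_tsum fun n => measurable_const.indicator (Wset_meas _ _ _ _ _ _)
      _ ≤ ∑ s : Fin (e + 1), ENNReal.ofReal (R ^ p) * (ENNReal.ofReal (Cs s) * (∑' k, f k) ^ (s : ℕ)) := by
          refine Finset.sum_le_sum fun s _ => ?_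
          rw [← tsum_pi_prod, ← ENNReal.tsum_mul_left, ← ENNReal.tsum_mul_left]
          refine ENNReal.tsum_le_tsum fun n => ?_
          refine (mul_le_mul_right (Hs s t n) _).trans (le_of_eq ?_)
          have hw : 0 ≤ ∏ j, wt e c0 ε' (n j) := Finset.prod_nonneg fun j _ => hwt _
          rw [← ENNReal.ofReal_prod_of_nonneg (fun j _ => by positivity), ← ENNReal.ofReal_mul (by positivity), ← ENNReal.ofReal_mul (hCs s).le, ← ENNReal.ofReal_mul hRp.le]
          congr 1
          rw [hD]
          simp only [← wt_mul e c0 ε' hc0']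
          rw [Finset.prod_mul_distrib (f := fun j => wt e c0 ε' (n j))]
          ring
      _ = ENNReal.ofReal (R ^ p) * B := by rw [hB, Finset.mul_sum]
  by_cases hint : Integrable F (volume.restrict Q)
  · have h0 : 0 ≤ᵐ[volume.restrict Q] F := by
      filter_upwards [ae_restrict_mem hQm] with y hy
      exact (hpt y hy).1
    rw [integral_eq_lintegral_of_nonneg_ae h0 hint.aestronglyMeasurable]
    have h1 := ENNReal.toReal_mono (ENNReal.mul_ne_top ENNReal.ofReal_ne_top hBtop) hlin
    rw [ENNReal.toReal_mul, ENNReal.toReal_ofReal hRp.le] at h1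
    refine h1.trans ?_
    nlinarith
  · rw [integral_undef hint]
    positivity

theorem fin_stmt (d : ℕ) (hd : 2 ≤ d) (ξ : Fin d → ℝ)
    (M0 : Matrix (Fin d) (Fin d) ℝ) (hM0 : M0.det = 1)
    (r η : ℝ) (hr : 0 < r) (hη0 : 0 < η) (hηd : η < (d : ℝ))
    (vc bc : (Matrix (Fin d) (Fin d) ℝ × (Fin d → ℝ)) → (Fin d → ℝ))
    (hsec : IsSiegelSection d vc bc)
    (ε : ℝ) (hε : 0 < ε) :
    ∃ C : ℝ, 0 < C ∧ ∀ R : ℝ, 2 ≤ R → ∀ t : ℝ, 0 < t →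
      (∫ y in {y : Fin (d - 1) → ℝ | ∀ i, |y i| ≤ 1},
        Ffun d R η r (vc (gElt d ξ M0 y t)) (bc (gElt d ξ M0 y t))) ≤
      C * R ^ (-((d : ℝ) - η) + ε) := by
  obtain ⟨e, rfl⟩ : ∃ e, d = e + 1 := ⟨d - 1, by omega⟩
  obtain ⟨C, hC, H⟩ := main_bound (by omega) ξ M0 hM0 vc bc hsec r η (min ε (((e + 1 : ℕ) : ℝ) - η)) hr hη0
    (lt_min hε (by linarith)) (min_le_right _ _)
  refine ⟨C, hC, fun R hR t ht => (H R hR t ht).trans ?_⟩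
  refine mul_le_mul_of_nonneg_left (Real.rpow_le_rpow_of_exponent_le (by linarith) ?_) hC.le
  have := min_le_left ε (((e + 1 : ℕ) : ℝ) - η)
  linarith

/-- quantitative escape-of-mass bound under (B1):
∫_{[-1,1]^{d-1}} F_{R,η,r}(Γ'(1,ξ)(M₀ñ(y)Φ_t,0)) dy ≪_ε R^{-(d-η)+ε}. -/
theorem stmt19 (d : ℕ) (hd : 2 ≤ d) (ξ : Fin d → ℝ)
    (M0 : Matrix (Fin d) (Fin d) ℝ) (hM0 : M0.det = 1)
    (r η : ℝ) (hr : 0 < r) (hη0 : 0 < η) (hηd : η < (d : ℝ))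
    (vc bc : (Matrix (Fin d) (Fin d) ℝ × (Fin d → ℝ)) → (Fin d → ℝ))
    (hsec : IsSiegelSection d vc bc)
    (ε : ℝ) (hε : 0 < ε) :
    ∃ C : ℝ, 0 < C ∧ ∀ R : ℝ, 2 ≤ R → ∀ t : ℝ, 0 < t →
      (∫ y in {y : Fin (d - 1) → ℝ | ∀ i, |y i| ≤ 1},
        Ffun d R η r (vc (gElt d ξ M0 y t)) (bc (gElt d ξ M0 y t))) ≤
      C * R ^ (-((d : ℝ) - η) + ε) := by
  exact fin_stmt d hd ξ M0 hM0 r η hr hη0 hηd vc bc hsec ε hε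

end
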